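/- Assume the standing assumptions with ρ > 0, the parameter conditions, λ⁻¹ > L_g, α ≤ ε⁻¹, and let {(X^k, Y^k, Z^k)} be generated by LSALM. Then for every integer K ≥ 1 and every δ > 0, the number of indices k ∈ {0, 1, …, K} with ‖G(X^k)‖_F > δ is at most 2K(Φ⁰ − f_min)/(ρδ²); equivalently, at least K − 2K(Φ⁰ − f_min)/(ρδ²) of the indices k ∈ {0,…,K} satisfy ‖(X^k)ᵀX^k − Iₙ‖_F ≤ δ. -/

import Mathlib

open Matrix

noncomputable section

/-- Frobenius inner product `⟨A,B⟩ = tr(AᵀB)`. -/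
def frobInner {m n : ℕ} (A B : Matrix (Fin m) (Fin n) ℝ) : ℝ := (Aᵀ * B).trace

/-- Frobenius norm. -/
def frobNorm {m n : ℕ} (A : Matrix (Fin m) (Fin n) ℝ) : ℝ := Real.sqrt (frobInner A A)

/-- Spectral (operator) norm of a matrix. -/
def specNorm {m n : ℕ} (A : Matrix (Fin m) (Fin n) ℝ) : ℝ :=
  ‖LinearMap.toContinuousLinearMap (Matrix.toEuclideanLin A)‖

/-- `G(X) := XᵀX − Iₙ`. -/
def Gm {m n : ℕ} (X : Matrix (Fin m) (Fin n) ℝ) : Matrix (Fin n) (Fin n) ℝ := Xᵀ * X - 1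

/-- `gradl` is the (Fréchet) gradient of `ℓ` w.r.t. the Frobenius inner product. -/
def IsGradientOf {m n : ℕ} (gradl : Matrix (Fin m) (Fin n) ℝ → Matrix (Fin m) (Fin n) ℝ)
    (ℓ : Matrix (Fin m) (Fin n) ℝ → ℝ) : Prop :=
  ∀ X : Matrix (Fin m) (Fin n) ℝ, ∀ c : ℝ, 0 < c → ∃ δ : ℝ, 0 < δ ∧
    ∀ H : Matrix (Fin m) (Fin n) ℝ, frobNorm H ≤ δ →
      |ℓ (X + H) - ℓ X - frobInner (gradl X) H| ≤ c * frobNorm H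

/-- Augmented Lagrangian `ℒ_ρ(X,Y) = f(X) + ⟨Y, G(X)⟩ + (ρ/2)‖G(X)‖_F²` with `f = ℓ + g`. -/
def Lag {m n : ℕ} (ℓ g : Matrix (Fin m) (Fin n) ℝ → ℝ) (ρ : ℝ)
    (X : Matrix (Fin m) (Fin n) ℝ) (Y : Matrix (Fin n) (Fin n) ℝ) : ℝ :=
  ℓ X + g X + frobInner Y (Gm X) + ρ / 2 * frobNorm (Gm X) ^ 2

/-- `F(X,Y,Z) = ℒ_ρ(X,Y) − (ε/2)‖Y‖_F² + (r/2)‖X−Z‖_F²`. -/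
def Ffun {m n : ℕ} (ℓ g : Matrix (Fin m) (Fin n) ℝ → ℝ) (ρ r ε : ℝ)
    (X : Matrix (Fin m) (Fin n) ℝ) (Y : Matrix (Fin n) (Fin n) ℝ)
    (Z : Matrix (Fin m) (Fin n) ℝ) : ℝ :=
  Lag ℓ g ρ X Y - ε / 2 * frobNorm Y ^ 2 + r / 2 * frobNorm (X - Z) ^ 2

/-- Dual function `d(Y,Z) = min_{X ∈ 𝒳} F(X,Y,Z)`. -/
def dfun {m n : ℕ} (𝒳 : Set (Matrix (Fin m) (Fin n) ℝ))
    (ℓ g : Matrix (Fin m) (Fin n) ℝ → ℝ) (ρ r ε : ℝ)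
    (Y : Matrix (Fin n) (Fin n) ℝ) (Z : Matrix (Fin m) (Fin n) ℝ) : ℝ :=
  sInf ((fun X => Ffun ℓ g ρ r ε X Y Z) '' 𝒳)

/-- Proximal function `p(Z) = max_{Y ∈ 𝒴} d(Y,Z)`. -/
def pfun {m n : ℕ} (𝒳 : Set (Matrix (Fin m) (Fin n) ℝ))
    (𝒴 : Set (Matrix (Fin n) (Fin n) ℝ))
    (ℓ g : Matrix (Fin m) (Fin n) ℝ → ℝ) (ρ r ε : ℝ)
    (Z : Matrix (Fin m) (Fin n) ℝ) : ℝ :=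
  sSup ((fun Y => dfun 𝒳 ℓ g ρ r ε Y Z) '' 𝒴)

/-- Potential function `Φ(X,Y,Z) = F(X,Y,Z) − 2d(Y,Z) + 2p(Z)`. -/
def Phi {m n : ℕ} (𝒳 : Set (Matrix (Fin m) (Fin n) ℝ))
    (𝒴 : Set (Matrix (Fin n) (Fin n) ℝ))
    (ℓ g : Matrix (Fin m) (Fin n) ℝ → ℝ) (ρ r ε : ℝ)
    (X : Matrix (Fin m) (Fin n) ℝ) (Y : Matrix (Fin n) (Fin n) ℝ)
    (Z : Matrix (Fin m) (Fin n) ℝ) : ℝ :=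
  Ffun ℓ g ρ r ε X Y Z - 2 * dfun 𝒳 ℓ g ρ r ε Y Z + 2 * pfun 𝒳 𝒴 ℓ g ρ r ε Z

/-- Linearized augmented Lagrangian `ℒ_{X̄,λ}(X,Y)`. -/
def LinLag {m n : ℕ} (ℓ g : Matrix (Fin m) (Fin n) ℝ → ℝ)
    (gradl : Matrix (Fin m) (Fin n) ℝ → Matrix (Fin m) (Fin n) ℝ) (ρ lam : ℝ)
    (Xb X : Matrix (Fin m) (Fin n) ℝ) (Y : Matrix (Fin n) (Fin n) ℝ) : ℝ :=
  ℓ Xb + frobInner Y (Gm Xb) + ρ / 2 * frobNorm (Gm Xb) ^ 2 + g X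
    + frobInner (gradl Xb) (X - Xb)
    + frobInner ((2 : ℝ) • (Xb * (Y + ρ • Gm Xb))) (X - Xb)
    + 1 / (2 * lam) * frobNorm (X - Xb) ^ 2

section Abstract

variable {E V : Type*} [NormedAddCommGroup E] [InnerProductSpace ℝ E]
  [NormedAddCommGroup V] [InnerProductSpace ℝ V]

open scoped RealInnerProductSpace

/-- First-order optimality for a smooth function plus a weakly convex function. -/
lemma first_order_optimality {X : Set E} (hX : Convex ℝ X) {g S : E → ℝ} {Lg C : ℝ}
    (hg : ConvexOn ℝ X (fun x => g x + Lg / 2 * ‖x‖ ^ 2)) {c x₀ : E} (hx₀ : x₀ ∈ X)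
    (hS : ∀ u ∈ X, S u ≤ S x₀ + ⟪c, u - x₀⟫ + C * ‖u - x₀‖ ^ 2)
    (hmin : ∀ u ∈ X, S x₀ + g x₀ ≤ S u + g u) {u : E} (hu : u ∈ X) :
    -(Lg / 2 * ‖u - x₀‖ ^ 2) ≤ ⟪c, u - x₀⟫ + g u - g x₀ := by
  have key : ∀ t : ℝ, 0 < t → t < 1 →
      -(Lg / 2 * ‖u - x₀‖ ^ 2) ≤ ⟪c, u - x₀⟫ + g u - g x₀
        + t * ((C - Lg / 2) * ‖u - x₀‖ ^ 2) := by
    intro t ht0 ht1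
    have hw : (1 - t) • x₀ + t • u ∈ X := hX hx₀ hu (by linarith) ht0.le (by ring)
    have hwe : (1 - t) • x₀ + t • u = x₀ + t • (u - x₀) := by module
    have h1 := hg.2 hx₀ hu (by linarith : (0 : ℝ) ≤ 1 - t) ht0.le (by ring)
    have h2 := hS _ hw
    have h3 := hmin _ hw
    have hwd : (1 - t) • x₀ + t • u - x₀ = t • (u - x₀) := by module
    rw [hwd, inner_smul_right, norm_smul, Real.norm_of_nonneg ht0.le] at h2
    simp only [smul_eq_mul] at h1
    have h4 : ‖(1 - t) • x₀ + t • u‖ ^ 2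
        = (1 - t) * ‖x₀‖ ^ 2 + t * ‖u‖ ^ 2 - t * (1 - t) * ‖u - x₀‖ ^ 2 := by
      rw [norm_add_sq_real, norm_sub_sq_real, norm_smul, norm_smul, inner_smul_left,
        inner_smul_right, real_inner_comm, Real.norm_of_nonneg ht0.le,
        Real.norm_of_nonneg (by linarith : (0 : ℝ) ≤ 1 - t)]
      simp
      ring
    rw [h4] at h1
    have h5 : 0 ≤ t * (⟪c, u - x₀⟫ + g u - g x₀
        + t * ((C - Lg / 2) * ‖u - x₀‖ ^ 2) + Lg / 2 * ‖u - x₀‖ ^ 2) := by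
      nlinarith
    have := nonneg_of_mul_nonneg_right h5 ht0
    linarith
  have hlim : Filter.Tendsto (fun t : ℝ => ⟪c, u - x₀⟫ + g u - g x₀
      + t * ((C - Lg / 2) * ‖u - x₀‖ ^ 2)) (nhdsWithin 0 (Set.Ioi 0))
      (nhds (⟪c, u - x₀⟫ + g u - g x₀ + 0 * ((C - Lg / 2) * ‖u - x₀‖ ^ 2))) := by
    refine Filter.Tendsto.mono_left ?_ nhdsWithin_le_nhds
    exact (Continuous.tendsto (by fun_prop) 0)
  have := ge_of_tendsto hlim (b := -(Lg / 2 * ‖u - x₀‖ ^ 2)) (by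
    filter_upwards [Ioo_mem_nhdsGT (zero_lt_one (α := ℝ))] with t ht using key t ht.1 ht.2)
  simpa using this

/-- Quadratic growth at a proximal minimizer. -/
lemma prox_quadratic_growth {X : Set E} (hX : Convex ℝ X) {g S : E → ℝ} {Lg C w r : ℝ}
    (hg : ConvexOn ℝ X (fun x => g x + Lg / 2 * ‖x‖ ^ 2)) {c x₀ z : E} (hx₀ : x₀ ∈ X)
    (hup : ∀ u ∈ X, S u ≤ S x₀ + ⟪c, u - x₀⟫ + C / 2 * ‖u - x₀‖ ^ 2)
    (hlo : ∀ u ∈ X, S x₀ + ⟪c, u - x₀⟫ - w / 2 * ‖u - x₀‖ ^ 2 ≤ S u)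
    (hmin : ∀ u ∈ X, S x₀ + g x₀ + r / 2 * ‖x₀ - z‖ ^ 2 ≤ S u + g u + r / 2 * ‖u - z‖ ^ 2)
    {u : E} (hu : u ∈ X) :
    S x₀ + g x₀ + r / 2 * ‖x₀ - z‖ ^ 2 + (r - Lg - w) / 2 * ‖u - x₀‖ ^ 2
      ≤ S u + g u + r / 2 * ‖u - z‖ ^ 2 := by
  have hq : ∀ v : E, ‖v - z‖ ^ 2 = ‖x₀ - z‖ ^ 2 + 2 * ⟪x₀ - z, v - x₀⟫ + ‖v - x₀‖ ^ 2 := by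
    intro v
    rw [← norm_add_sq_real]; congr 2; abel
  have h := first_order_optimality hX hg (S := fun v => S v + r / 2 * ‖v - z‖ ^ 2)
    (c := c + r • (x₀ - z)) (C := C / 2 + r / 2) hx₀
    (fun v hv => by
      have := hup v hv
      rw [hq v, inner_add_left, inner_smul_left]
      simp only [conj_trivial]
      nlinarith)
    (fun v hv => by have := hmin v hv; linarith) hu
  have := hlo u hu
  rw [inner_add_left, inner_smul_left] at h
  simp only [conj_trivial] at h
  rw [hq u]
  nlinarith

/-- Decrease of the objective along one proximal linearized step. -/
lemma prox_linear_descent {X : Set E} (hX : Convex ℝ X) {g S : E → ℝ} {Lg C r κ : ℝ}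
    (hg : ConvexOn ℝ X (fun x => g x + Lg / 2 * ‖x‖ ^ 2)) {c x x' z : E} (hx : x ∈ X)
    (hx' : x' ∈ X)
    (hup : S x' ≤ S x + ⟪c, x' - x⟫ + C / 2 * ‖x' - x‖ ^ 2)
    (hmin : ∀ u ∈ X, ⟪c, x' - x⟫ + g x' + κ / 2 * ‖x' - x‖ ^ 2 + r / 2 * ‖x' - z‖ ^ 2
      ≤ ⟪c, u - x⟫ + g u + κ / 2 * ‖u - x‖ ^ 2 + r / 2 * ‖u - z‖ ^ 2) :
    S x' + g x' + r / 2 * ‖x' - z‖ ^ 2 + (κ + (r - Lg - C) / 2) * ‖x - x'‖ ^ 2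
      ≤ S x + g x + r / 2 * ‖x - z‖ ^ 2 := by
  have hq : ∀ v : E, κ / 2 * ‖v - x‖ ^ 2 = κ / 2 * ‖x' - x‖ ^ 2 + κ * ⟪x' - x, v - x'⟫
      + κ / 2 * ‖v - x'‖ ^ 2 := by
    intro v
    have : ‖v - x‖ ^ 2 = ‖x' - x‖ ^ 2 + 2 * ⟪x' - x, v - x'⟫ + ‖v - x'‖ ^ 2 := by
      rw [← norm_add_sq_real]; congr 2; abel
    rw [this]; ring
  have h := prox_quadratic_growth hX (S := fun v => ⟪c, v - x⟫ + κ / 2 * ‖v - x‖ ^ 2)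
    (w := -κ) (C := κ) (r := r) (z := z) hg (c := c + κ • (x' - x)) hx'
    (fun v _ => by
      rw [hq v, inner_add_left, inner_smul_left]
      have : ⟪c, v - x⟫ = ⟪c, x' - x⟫ + ⟪c, v - x'⟫ := by
        rw [← inner_add_right]; congr 1; abel
      simp only [conj_trivial]
      linarith)
    (fun v _ => by
      rw [hq v, inner_add_left, inner_smul_left]
      have : ⟪c, v - x⟫ = ⟪c, x' - x⟫ + ⟪c, v - x'⟫ := by
        rw [← inner_add_right]; congr 1; abel
      simp only [conj_trivial]
      linarith)
    (fun v hv => by have := hmin v hv; linarith) hx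
  simp only [sub_self, inner_zero_right, norm_zero] at h
  rw [norm_sub_rev x' x] at hup h
  nlinarith

/-- Distance from one proximal linearized step to the exact proximal minimizer. -/
lemma prox_linear_error {X : Set E} (hX : Convex ℝ X) {g S : E → ℝ} {Lg C w r κ : ℝ}
    (hg : ConvexOn ℝ X (fun x => g x + Lg / 2 * ‖x‖ ^ 2)) {c x x' xs z : E}
    (hx' : x' ∈ X) (hxs : xs ∈ X) (hw : 0 ≤ w) (hwC : w ≤ C) (hκ : 0 ≤ κ)
    (hup : S x' ≤ S x + ⟪c, x' - x⟫ + C / 2 * ‖x' - x‖ ^ 2)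
    (hlo : S x + ⟪c, xs - x⟫ - w / 2 * ‖xs - x‖ ^ 2 ≤ S xs)
    (hmin : ∀ u ∈ X, ⟪c, x' - x⟫ + g x' + κ / 2 * ‖x' - x‖ ^ 2 + r / 2 * ‖x' - z‖ ^ 2
      ≤ ⟪c, u - x⟫ + g u + κ / 2 * ‖u - x‖ ^ 2 + r / 2 * ‖u - z‖ ^ 2)
    (hgrow : S xs + g xs + r / 2 * ‖xs - z‖ ^ 2 + (r - Lg - w) / 2 * ‖x' - xs‖ ^ 2
      ≤ S x' + g x' + r / 2 * ‖x' - z‖ ^ 2) :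
    (r - Lg - w) * ‖xs - x'‖ ^ 2 ≤ (κ + C) * ‖xs - x'‖ * ‖x - x'‖ + C * ‖x - x'‖ ^ 2 := by
  have hq : ∀ v : E, κ / 2 * ‖v - x‖ ^ 2 = κ / 2 * ‖x' - x‖ ^ 2 + κ * ⟪x' - x, v - x'⟫
      + κ / 2 * ‖v - x'‖ ^ 2 := by
    intro v
    have : ‖v - x‖ ^ 2 = ‖x' - x‖ ^ 2 + 2 * ⟪x' - x, v - x'⟫ + ‖v - x'‖ ^ 2 := by
      rw [← norm_add_sq_real]; congr 2; abel
    rw [this]; ring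
  have hc : ∀ v : E, ⟪c, v - x⟫ = ⟪c, x' - x⟫ + ⟪c, v - x'⟫ := by
    intro v
    rw [← inner_add_right]; congr 1; abel
  have h := prox_quadratic_growth hX (S := fun v => ⟪c, v - x⟫ + κ / 2 * ‖v - x‖ ^ 2)
    (w := -κ) (C := κ) (r := r) (z := z) hg (c := c + κ • (x' - x)) hx'
    (fun v _ => by
      rw [hq v, inner_add_left, inner_smul_left]
      have := hc v
      simp only [conj_trivial]
      linarith)
    (fun v _ => by
      rw [hq v, inner_add_left, inner_smul_left]
      have := hc v
      simp only [conj_trivial]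
      linarith)
    (fun v hv => by have := hmin v hv; linarith) hxs
  rw [hq xs] at h
  have hcs : ⟪x' - x, xs - x'⟫ ≤ ‖x - x'‖ * ‖xs - x'‖ := by
    rw [norm_sub_rev x x']; exact real_inner_le_norm _ _
  have htri : ‖xs - x‖ ≤ ‖xs - x'‖ + ‖x - x'‖ := by
    rw [norm_sub_rev x x']; exact norm_sub_le_norm_sub_add_norm_sub _ _ _
  rw [norm_sub_rev x' xs] at hgrow
  rw [norm_sub_rev x' x] at hup
  have h1 : κ * ⟪x' - x, xs - x'⟫ ≤ κ * (‖x - x'‖ * ‖xs - x'‖) :=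
    mul_le_mul_of_nonneg_left hcs hκ
  have h2 : w * ‖xs - x‖ ^ 2 ≤ w * (‖xs - x'‖ + ‖x - x'‖) ^ 2 := by gcongr
  have h3 : (C - w) * (‖xs - x'‖ * ‖x - x'‖) ≥ 0 :=
    mul_nonneg (by linarith) (by positivity)
  have h4 : (C - w) * ‖x - x'‖ ^ 2 ≥ 0 := mul_nonneg (by linarith) (by positivity)
  nlinarith

/-- The regularized saddle function with dual coupling `⟪y, G x⟫`. -/
def saddleFun (φ : E → ℝ) (G : E → V) (ε r : ℝ) (x : E) (y : V) (z : E) : ℝ :=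
  φ x + ⟪y, G x⟫ - ε / 2 * ‖y‖ ^ 2 + r / 2 * ‖x - z‖ ^ 2

lemma saddleFun_dual_expand (φ : E → ℝ) (G : E → V) (ε r : ℝ) (x : E) (y y' : V) (z : E) :
    saddleFun φ G ε r x y' z = saddleFun φ G ε r x y z + ⟪G x - ε • y, y' - y⟫
      - ε / 2 * ‖y' - y‖ ^ 2 := by
  unfold saddleFun
  rw [norm_sub_sq_real y' y, inner_sub_left, inner_sub_right, inner_sub_right, inner_smul_left,
    inner_smul_left, real_inner_self_eq_norm_sq, real_inner_comm y (G x),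
    real_inner_comm y' (G x), real_inner_comm y' y]
  simp only [conj_trivial]
  ring

lemma saddleFun_center_expand (φ : E → ℝ) (G : E → V) (ε r : ℝ) (x : E) (y : V) (z z' : E) :
    saddleFun φ G ε r x y z' = saddleFun φ G ε r x y z + r / 2 * ⟪z' - z, z' + z - (2 : ℝ) • x⟫ := by
  unfold saddleFun
  have h1 : ‖x - z'‖ ^ 2 = ‖x - z‖ ^ 2 + ⟪z' - z, z' + z - (2 : ℝ) • x⟫ := by
    rw [norm_sub_sq_real, norm_sub_sq_real, inner_sub_right, inner_add_right, inner_sub_left,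
      inner_sub_left, inner_sub_left, inner_smul_right, inner_smul_right,
      real_inner_self_eq_norm_sq, real_inner_self_eq_norm_sq, real_inner_comm z z',
      real_inner_comm z x, real_inner_comm z' x]
    ring
  rw [h1]; ring

section Saddle

variable {X : Set E} {Y : Set V} {φ : E → ℝ} {G : E → V} {ε r s R : ℝ} {m : V → E → E}

/-- Lipschitz dependence of the proximal minimizer on the multiplier. -/
lemma minimizer_dual_lipschitz (hs : 0 < s) (hR : 0 ≤ R) (hm : ∀ y z, m y z ∈ X)
    (hG : ∀ u ∈ X, ∀ v ∈ X, ‖G u - G v‖ ≤ 2 * R * ‖u - v‖)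
    (hgrow : ∀ y ∈ Y, ∀ z, ∀ u ∈ X, saddleFun φ G ε r (m y z) y z + s / 2 * ‖u - m y z‖ ^ 2
      ≤ saddleFun φ G ε r u y z) {y y' : V} (hy : y ∈ Y) (hy' : y' ∈ Y) (z : E) :
    ‖m y' z - m y z‖ ≤ 2 * R / s * ‖y - y'‖ := by
  have h1 := hgrow y hy z _ (hm y' z)
  have h2 := hgrow y' hy' z _ (hm y z)
  rw [saddleFun_dual_expand φ G ε r _ y y', saddleFun_dual_expand φ G ε r _ y y'] at h2
  rw [norm_sub_rev (m y z)] at h2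
  have h3 : ⟪G (m y z) - ε • y, y' - y⟫ - ⟪G (m y' z) - ε • y, y' - y⟫
      = ⟪G (m y z) - G (m y' z), y' - y⟫ := by
    rw [← inner_sub_left]; congr 1; abel
  have h4 := real_inner_le_norm (G (m y z) - G (m y' z)) (y' - y)
  have h5 := hG _ (hm y z) _ (hm y' z)
  rw [norm_sub_rev (m y z)] at h5
  rw [norm_sub_rev y' y] at h4
  have h6 := mul_le_mul_of_nonneg_right h5 (norm_nonneg (y - y'))
  rw [div_mul_eq_mul_div, le_div_iff₀ hs]
  rcases (norm_nonneg (m y' z - m y z)).eq_or_lt with h0 | h0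
  · rw [← h0]; simp; positivity
  · refine le_of_mul_le_mul_left ?_ h0
    nlinarith

/-- Lipschitz dependence of the proximal minimizer on the center. -/
lemma minimizer_center_lipschitz (hs : 0 < s) (hr : 0 ≤ r) (hm : ∀ y z, m y z ∈ X)
    (hgrow : ∀ y ∈ Y, ∀ z, ∀ u ∈ X, saddleFun φ G ε r (m y z) y z + s / 2 * ‖u - m y z‖ ^ 2
      ≤ saddleFun φ G ε r u y z) {y : V} (hy : y ∈ Y) (z z' : E) :
    ‖m y z' - m y z‖ ≤ r / s * ‖z - z'‖ := by
  have h1 := hgrow y hy z _ (hm y z')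
  have h2 := hgrow y hy z' _ (hm y z)
  rw [saddleFun_center_expand φ G ε r _ y z z', saddleFun_center_expand φ G ε r _ y z z'] at h2
  rw [norm_sub_rev (m y z)] at h2
  have h3 : ⟪z' - z, z' + z - (2 : ℝ) • m y z⟫ - ⟪z' - z, z' + z - (2 : ℝ) • m y z'⟫
      = 2 * ⟪z' - z, m y z' - m y z⟫ := by
    rw [← inner_sub_right, ← inner_smul_right]; congr 1; module
  have h4 := real_inner_le_norm (z' - z) (m y z' - m y z)
  rw [norm_sub_rev z' z] at h4
  have h6 := mul_le_mul_of_nonneg_left h4 hr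
  rw [div_mul_eq_mul_div, le_div_iff₀ hs]
  rcases (norm_nonneg (m y z' - m y z)).eq_or_lt with h0 | h0
  · rw [← h0]; simp; positivity
  · refine le_of_mul_le_mul_left ?_ h0
    nlinarith

/-- Dual error bound: distance between the minimizers at a multiplier and at the dual
maximizer, in terms of a bound for the dual gradient in the direction of the maximizer. -/
lemma dual_error_bound (hs : 0 < s) (hε : 0 < ε) (hm : ∀ y z, m y z ∈ X)
    (hgrow : ∀ y ∈ Y, ∀ z, ∀ u ∈ X, saddleFun φ G ε r (m y z) y z + s / 2 * ‖u - m y z‖ ^ 2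
      ≤ saddleFun φ G ε r u y z) {y ys : V} (hys : ys ∈ Y) {z : E} {M : ℝ} (hM : 0 ≤ M)
    (hmax : saddleFun φ G ε r (m y z) y z ≤ saddleFun φ G ε r (m ys z) ys z)
    (hgrad : ⟪G (m y z) - ε • y, ys - y⟫ ≤ M * ‖ys - y‖) :
    ‖m ys z - m y z‖ ≤ 1 / (√s * √ε) * M := by
  have h1 := hgrow ys hys z _ (hm y z)
  rw [saddleFun_dual_expand φ G ε r (m y z) y ys z] at h1
  rw [norm_sub_rev (m y z)] at h1
  have h2 : s * ‖m ys z - m y z‖ ^ 2 + ε * ‖ys - y‖ ^ 2 ≤ 2 * (M * ‖ys - y‖) := by linarith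
  have h3 : s * ε * ‖m ys z - m y z‖ ^ 2 ≤ M ^ 2 := by
    nlinarith [sq_nonneg (M - ε * ‖ys - y‖), mul_le_mul_of_nonneg_left h2 hε.le]
  have hss : 0 < √s := Real.sqrt_pos.2 hs
  have hse : 0 < √ε := Real.sqrt_pos.2 hε
  rw [div_mul_eq_mul_div, one_mul, le_div_iff₀ (by positivity)]
  refine abs_le_of_sq_le_sq' ?_ hM |>.2
  calc (‖m ys z - m y z‖ * (√s * √ε)) ^ 2
      = √s ^ 2 * √ε ^ 2 * ‖m ys z - m y z‖ ^ 2 := by ring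
    _ = s * ε * ‖m ys z - m y z‖ ^ 2 := by rw [Real.sq_sqrt hs.le, Real.sq_sqrt hε.le]
    _ ≤ M ^ 2 := h3

end Saddle

set_option maxHeartbeats 1000000 in
/-- The scalar inequality behind the decrease of the potential function. -/
lemma descent_scalar_bound {a b c Δ r s R α β ε ζ κ τ : ℝ} (ha : 0 ≤ a) (hb : 0 ≤ b)
    (hc : 0 ≤ c) (hR : 0 < R) (hs : 0 < s) (hr4 : 4 * R ≤ r) (hrs : r / s ≤ 3 / 2)
    (hs4 : 4 * R ≤ s) (hα : 0 < α) (hαR : α * R ≤ 1 / 20) (hζ : 0 ≤ ζ)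
    (hαζ : α * R * ζ ^ 2 ≤ 1 / 8) (hε : 0 < ε) (hβ : 0 < β) (hβ1 : β ≤ 1 / 28) (hτ : 0 < τ)
    (hω : r * (τ * (1 / α + 2 * (2 * R / s) * R + ε)) ^ 2 * α * β ≤ 1 / 448)
    (hαε : ε ≤ 1 / α) (hκ : 2 * R ≤ κ)
    (hΔ : Δ ≤ τ * ((1 / α - ε) * b + 2 * R * (r / s * c + 2 * R / s * b + ζ * a))) :
    0 ≤ (κ + 2 * R) * a ^ 2 + (1 / α - ε / 2) * b ^ 2 - 4 * R * (2 * R / s * b + ζ * a) * b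
      + r * (2 - β) / (2 * β) * c ^ 2 - 2 * r * c * (r / s * c + Δ) := by
  have hr : 0 < r := by linarith
  have hσ : 2 * R / s ≤ 1 / 2 := by rw [div_le_iff₀ hs]; linarith
  have hσ0 : 0 ≤ 2 * R / s := by positivity
  set σ := 2 * R / s
  set q := r / s
  obtain ⟨ω, hωdef⟩ : ∃ ω, ω = τ * (1 / α + 2 * σ * R + ε) := ⟨_, rfl⟩
  rw [← hωdef] at hω
  have hω0 : 0 < ω := by rw [hωdef]; positivity
  have hτω : τ ≤ ω * α := by
    rw [hωdef]
    have : τ * (1 / α + 2 * σ * R + ε) * α = τ + τ * α * (2 * σ * R + ε) := by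
      field_simp
      ring
    rw [this]
    have : 0 ≤ τ * α * (2 * σ * R + ε) := by positivity
    linarith
  have hΔ2 : Δ ≤ ω * b + ω * α * (3 * R * c + 2 * R * ζ * a) := by
    refine hΔ.trans ?_
    have h1 : τ * ((1 / α - ε) * b + 2 * R * (q * c + σ * b + ζ * a))
        = τ * (1 / α - ε + 2 * σ * R) * b + τ * (2 * R * q * c + 2 * R * ζ * a) := by ring
    have h2 : τ * (1 / α - ε + 2 * σ * R) * b ≤ ω * b := by
      have h4 : 1 / α - ε + 2 * σ * R ≤ 1 / α + 2 * σ * R + ε := by linarith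
      rw [hωdef]
      exact mul_le_mul_of_nonneg_right (mul_le_mul_of_nonneg_left h4 hτ.le) hb
    have h3 : τ * (2 * R * q * c + 2 * R * ζ * a) ≤ ω * α * (3 * R * c + 2 * R * ζ * a) := by
      have : 2 * R * q * c ≤ 3 * R * c := by nlinarith [mul_nonneg hR.le hc]
      have h0 : 0 ≤ 3 * R * c + 2 * R * ζ * a := by positivity
      calc _ ≤ τ * (3 * R * c + 2 * R * ζ * a) := by gcongr
        _ ≤ _ := by gcongr
    linarith
  have hB : α * R * ω * β ≤ 1 / 180 := by
    have h1 : (α * R * ω * β) ^ 2 ≤ (1 / 180) ^ 2 := by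
      have h2 : (α * R * ω * β) ^ 2 * 4 ≤ (α * R) * (r * ω ^ 2 * α * β) * β := by
        have : (α * R) * (r * ω ^ 2 * α * β) * β - (α * R * ω * β) ^ 2 * 4
          = (α * ω * β) ^ 2 * R * (r - 4 * R) := by ring
        have h3 : 0 ≤ (α * ω * β) ^ 2 * R * (r - 4 * R) :=
          mul_nonneg (by positivity) (by linarith)
        linarith
      have h4 : (α * R) * (r * ω ^ 2 * α * β) * β ≤ 1 / 20 * (1 / 448) * (1 / 28) := by
        gcongr
      norm_num at h4 ⊢
      linarith
    exact (abs_le_of_sq_le_sq' h1 (by norm_num)).2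
  have hbc : 2 * r * ω * (b * c) ≤ r / (4 * β) * c ^ 2 + 1 / (112 * α) * b ^ 2 := by
    have h1 : 4 * r * β * ω ^ 2 ≤ 1 / (112 * α) := by
      rw [le_div_iff₀ (by positivity)]; linarith
    have h2 : 4 * r * β * ω ^ 2 * b ^ 2 ≤ 1 / (112 * α) * b ^ 2 := by gcongr
    have h3 : r / (4 * β) * c ^ 2 + 4 * r * β * ω ^ 2 * b ^ 2 - 2 * r * ω * (b * c)
        = r / (4 * β) * (c - 4 * β * ω * b) ^ 2 := by field_simp; ring
    have h4 : 0 ≤ r / (4 * β) * (c - 4 * β * ω * b) ^ 2 := by positivity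
    linarith
  have hac : 4 * r * (ω * α * R * ζ) * (a * c) ≤ r / (4 * β) * c ^ 2 + R / 28 * a ^ 2 := by
    have h1 : 16 * r * β * (ω * α * R * ζ) ^ 2 ≤ R / 28 := by
      have : 16 * r * β * (ω * α * R * ζ) ^ 2
        = 16 * R * (r * ω ^ 2 * α * β) * (α * R * ζ ^ 2) := by ring
      rw [this]
      calc _ ≤ 16 * R * (1 / 448) * (1 / 8) := by gcongr
        _ ≤ R / 28 := by linarith
    have h2 : 16 * r * β * (ω * α * R * ζ) ^ 2 * a ^ 2 ≤ R / 28 * a ^ 2 := by gcongr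
    have h3 : r / (4 * β) * c ^ 2 + 16 * r * β * (ω * α * R * ζ) ^ 2 * a ^ 2
        - 4 * r * (ω * α * R * ζ) * (a * c)
        = r / (4 * β) * (c - 8 * β * (ω * α * R * ζ) * a) ^ 2 := by field_simp; ring
    have h4 : 0 ≤ r / (4 * β) * (c - 8 * β * (ω * α * R * ζ) * a) ^ 2 := by positivity
    linarith
  have hcc : 6 * r * (ω * α * R) * c ^ 2 ≤ r / (30 * β) * c ^ 2 := by
    gcongr
    rw [le_div_iff₀ (by positivity)]
    have := mul_le_mul_of_nonneg_left hB hr.le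
    linarith
  have hqc : 2 * r * q * c ^ 2 ≤ 3 * r * c ^ 2 := by
    have : 2 * r * q ≤ 3 * r := by nlinarith
    gcongr
  have hcr : 2 * r * c * (q * c + Δ) ≤ 3 * r * c ^ 2 + r / (30 * β) * c ^ 2
      + (r / (4 * β) * c ^ 2 + 1 / (112 * α) * b ^ 2)
      + (r / (4 * β) * c ^ 2 + R / 28 * a ^ 2) := by
    have h1 : 2 * r * c * Δ ≤ 2 * r * c * (ω * b + ω * α * (3 * R * c + 2 * R * ζ * a)) := by
      gcongr
    linarith
  have hcfin : 3 * r * c ^ 2 + r / (30 * β) * c ^ 2 + r / (4 * β) * c ^ 2 + r / (4 * β) * c ^ 2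
      ≤ r * (2 - β) / (2 * β) * c ^ 2 := by
    rw [← add_mul, ← add_mul, ← add_mul]
    gcongr
    have : r * (2 - β) / (2 * β) - (3 * r + r / (30 * β) + r / (4 * β) + r / (4 * β))
        = r / β * (1 - β / 2 - 3 * β - 1 / 30 - 1 / 2) := by field_simp; ring
    have h0 : 0 ≤ r / β * (1 - β / 2 - 3 * β - 1 / 30 - 1 / 2) :=
      mul_nonneg (by positivity) (by linarith)
    linarith
  have hRα : R ≤ 1 / (20 * α) := by
    rw [le_div_iff₀ (by positivity)]; linarith
  have hab : 4 * R * (σ * b + ζ * a) * b ≤ 1 / (10 * α) * b ^ 2 + 2 * R * a ^ 2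
      + 1 / (4 * α) * b ^ 2 := by
    have h1 : 4 * R * σ * b ^ 2 ≤ 1 / (10 * α) * b ^ 2 := by
      gcongr
      have : 1 / (10 * α) = 2 * (1 / (20 * α)) := by field_simp; norm_num
      have h3 : R * σ ≤ R * (1 / 2) := mul_le_mul_of_nonneg_left hσ hR.le
      rw [this]
      linarith
    have h2 : 2 * R * ζ ^ 2 * b ^ 2 ≤ 1 / (4 * α) * b ^ 2 := by
      gcongr
      rw [le_div_iff₀ (by positivity)]; linarith
    have h3 : 0 ≤ 2 * R * (a - ζ * b) ^ 2 := by positivity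
    linarith
  have hbfin : 1 / (10 * α) * b ^ 2 + 1 / (4 * α) * b ^ 2 + 1 / (112 * α) * b ^ 2
      ≤ (1 / α - ε / 2) * b ^ 2 := by
    rw [← add_mul, ← add_mul]
    gcongr
    have h1 : 1 / (10 * α) + 1 / (4 * α) + 1 / (112 * α) ≤ 1 / 2 * (1 / α) := by
      have : 1 / (10 * α) + 1 / (4 * α) + 1 / (112 * α) = (1 / 10 + 1 / 4 + 1 / 112) * (1 / α) := by
        field_simp
      rw [this]; gcongr; norm_num
    linarith
  have hafin : 2 * R * a ^ 2 + R / 28 * a ^ 2 ≤ (κ + 2 * R) * a ^ 2 := by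
    rw [← add_mul]; gcongr; linarith
  linarith

/-- Decrease of the potential function along one step of the smoothed primal-dual iteration. -/
lemma potential_descent {X : Set E} {Y : Set V} {φ : E → ℝ} {G : E → V}
    {ε r s R α β ζ κ p : ℝ} {m : V → E → E} (hm : ∀ y z, m y z ∈ X)
    (hG : ∀ u ∈ X, ∀ v ∈ X, ‖G u - G v‖ ≤ 2 * R * ‖u - v‖)
    (hgrow : ∀ y ∈ Y, ∀ z, ∀ u ∈ X, saddleFun φ G ε r (m y z) y z + s / 2 * ‖u - m y z‖ ^ 2
      ≤ saddleFun φ G ε r u y z)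
    (hR : 0 < R) (hs : 0 < s) (hr4 : 4 * R ≤ r) (hrs : r / s ≤ 3 / 2)
    (hs4 : 4 * R ≤ s) (hα : 0 < α) (hαR : α * R ≤ 1 / 20) (hζ : 0 ≤ ζ)
    (hαζ : α * R * ζ ^ 2 ≤ 1 / 8) (hε : 0 < ε) (hβ : 0 < β) (hβ1 : β ≤ 1 / 28)
    (hω : r * (1 / (√s * √ε) * (1 / α + 2 * (2 * R / s) * R + ε)) ^ 2 * α * β ≤ 1 / 448)
    (hαε : ε ≤ 1 / α) (hκ : 2 * R ≤ κ)
    {x x' z z' : E} {y y' ys : V} (hx' : x' ∈ X) (hy : y ∈ Y) (hy' : y' ∈ Y)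
    (hys : ys ∈ Y)
    (hprimal : saddleFun φ G ε r x' y z + (κ + 2 * R) * ‖x - x'‖ ^ 2 ≤ saddleFun φ G ε r x y z)
    (herr : ‖m y z - x'‖ ≤ ζ * ‖x - x'‖) (hz' : z' = z + β • (x' - z))
    (hproj : ∀ w ∈ Y, ⟪y + α • (G x' - ε • y) - y', w - y'⟫ ≤ 0)
    (hmax : saddleFun φ G ε r (m y' z') y' z' ≤ saddleFun φ G ε r (m ys z') ys z')
    (hp : saddleFun φ G ε r (m ys z) ys z ≤ p) :
    saddleFun φ G ε r x' y' z' - 2 * saddleFun φ G ε r (m y' z') y' z'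
        + 2 * saddleFun φ G ε r (m ys z') ys z'
      ≤ saddleFun φ G ε r x y z - 2 * saddleFun φ G ε r (m y z) y z + 2 * p := by
  have hr : 0 < r := by linarith
  have hmin : ∀ y ∈ Y, ∀ z, ∀ u ∈ X, saddleFun φ G ε r (m y z) y z ≤ saddleFun φ G ε r u y z := by
    intro y hy z u hu
    have h1 := hgrow y hy z u hu
    have : 0 ≤ s / 2 * ‖u - m y z‖ ^ 2 := by positivity
    linarith
  have hτ : 0 < 1 / (√s * √ε) := by
    have := Real.sqrt_pos.2 hs
    have := Real.sqrt_pos.2 hε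
    positivity
  have e1 := saddleFun_dual_expand φ G ε r x' y y' z
  have e2 := saddleFun_center_expand φ G ε r x' y' z z'
  have e3 := saddleFun_dual_expand φ G ε r (m y' z) y y' z
  have e3' := hmin y hy z _ (hm y' z)
  have e4 := saddleFun_center_expand φ G ε r (m y' z') y' z z'
  have e4' := hmin y' hy' z _ (hm y' z')
  have e5 := saddleFun_center_expand φ G ε r (m ys z) ys z z'
  have e5' := hmin ys hys z' _ (hm ys z)
  have l1 : ‖m y' z - m y z‖ ≤ 2 * R / s * ‖y' - y‖ := by
    rw [norm_sub_rev y' y]; exact minimizer_dual_lipschitz hs hR.le hm hG hgrow hy hy' z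
  have l2 : ‖m y' z' - m y' z‖ ≤ r / s * ‖z' - z‖ := by
    rw [norm_sub_rev z' z]; exact minimizer_center_lipschitz hs hr.le hm hgrow hy' z z'
  have l3 : ‖m ys z' - m ys z‖ ≤ r / s * ‖z' - z‖ := by
    rw [norm_sub_rev z' z]; exact minimizer_center_lipschitz hs hr.le hm hgrow hys z z'
  have t1 : ‖m y' z - x'‖ ≤ 2 * R / s * ‖y' - y‖ + ζ * ‖x - x'‖ := by
    have := norm_sub_le_norm_sub_add_norm_sub (m y' z) (m y z) x'
    linarith
  have t2 : ‖m y' z' - x'‖ ≤ r / s * ‖z' - z‖ + 2 * R / s * ‖y' - y‖ + ζ * ‖x - x'‖ := by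
    have := norm_sub_le_norm_sub_add_norm_sub (m y' z') (m y' z) x'
    linarith
  have hM : 0 ≤ (1 / α - ε) * ‖y' - y‖
      + 2 * R * (r / s * ‖z' - z‖ + 2 * R / s * ‖y' - y‖ + ζ * ‖x - x'‖) := by
    have : 0 ≤ 1 / α - ε := by linarith
    positivity
  have hgrad : ⟪G (m y' z') - ε • y', ys - y'⟫ ≤ ((1 / α - ε) * ‖y' - y‖
      + 2 * R * (r / s * ‖z' - z‖ + 2 * R / s * ‖y' - y‖ + ζ * ‖x - x'‖)) * ‖ys - y'‖ := by
    have h1 := hproj ys hys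
    have h2 : y + α • (G x' - ε • y) - y'
        = α • ((G (m y' z') - ε • y') - (G (m y' z') - G x') - (1 / α - ε) • (y' - y)) := by
      have : α * (1 / α) = 1 := by field_simp
      simp only [smul_sub, smul_smul, sub_smul, this, one_smul]
      abel
    rw [h2, inner_smul_left, inner_sub_left, inner_sub_left (G (m y' z') - ε • y'),
      inner_smul_left] at h1
    simp only [conj_trivial] at h1
    have h3 := nonpos_of_mul_nonpos_right h1 hα
    have h4 := real_inner_le_norm (G (m y' z') - G x') (ys - y')
    have h5 := real_inner_le_norm (y' - y) (ys - y')
    have h6 := hG _ (hm y' z') _ hx'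
    have h7 : ‖G (m y' z') - G x'‖ * ‖ys - y'‖ ≤ 2 * R * (r / s * ‖z' - z‖
        + 2 * R / s * ‖y' - y‖ + ζ * ‖x - x'‖) * ‖ys - y'‖ := by
      gcongr
      exact h6.trans (by gcongr)
    have h8 := mul_le_mul_of_nonneg_left h5 (by linarith : 0 ≤ 1 / α - ε)
    linarith
  have hΔ := dual_error_bound hs hε hm hgrow hys hM hmax hgrad
  have hfin := descent_scalar_bound (norm_nonneg (x - x')) (norm_nonneg (y' - y))
    (norm_nonneg (z' - z)) hR hs hr4 hrs hs4 hα hαR hζ hαζ hε hβ hβ1 hτ hω hαε hκ hΔ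
  have i1 : 1 / α * ‖y' - y‖ ^ 2 ≤ ⟪G x' - ε • y, y' - y⟫ := by
    have h1 := hproj y hy
    have h2 : y + α • (G x' - ε • y) - y' = α • (G x' - ε • y) - (y' - y) := by abel
    have h3 : y - y' = -(y' - y) := by abel
    rw [h2, h3, inner_neg_right, inner_sub_left, inner_smul_left, real_inner_self_eq_norm_sq] at h1
    simp only [conj_trivial] at h1
    rw [div_mul_eq_mul_div, div_le_iff₀ hα]
    linarith
  have i2 : ⟪G x' - ε • y, y' - y⟫ - ⟪G (m y' z) - ε • y, y' - y⟫
      ≤ 2 * R * (2 * R / s * ‖y' - y‖ + ζ * ‖x - x'‖) * ‖y' - y‖ := by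
    rw [← inner_sub_left]
    refine (real_inner_le_norm _ _).trans ?_
    gcongr
    have : G x' - ε • y - (G (m y' z) - ε • y) = -(G (m y' z) - G x') := by abel
    rw [this, norm_neg]
    exact (hG _ (hm y' z) _ hx').trans (by gcongr)
  have i3 : r / 2 * ⟪z' - z, z' + z - (2 : ℝ) • x'⟫
      = -(r * (2 - β) / (2 * β) * ‖z' - z‖ ^ 2) := by
    have h1 : z' - z = β • (x' - z) := by rw [hz']; abel
    have h2 : z' + z - (2 : ℝ) • x' = (β - 2) • (x' - z) := by rw [hz']; module
    rw [h2, h1, inner_smul_left, inner_smul_right, real_inner_self_eq_norm_sq, norm_smul, mul_pow,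
      Real.norm_of_nonneg hβ.le]
    simp only [conj_trivial]
    field_simp
    ring
  have i4 : ⟪z' - z, z' + z - (2 : ℝ) • m ys z⟫ - ⟪z' - z, z' + z - (2 : ℝ) • m y' z'⟫
      ≤ 2 * (‖z' - z‖ * (r / s * ‖z' - z‖ + ‖m ys z' - m y' z'‖)) := by
    have h1 : ⟪z' - z, z' + z - (2 : ℝ) • m ys z⟫ - ⟪z' - z, z' + z - (2 : ℝ) • m y' z'⟫
      = 2 * ⟪z' - z, m y' z' - m ys z⟫ := by
      rw [← inner_sub_right, ← inner_smul_right]; congr 1; module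
    rw [h1]
    have h2 := real_inner_le_norm (z' - z) (m y' z' - m ys z)
    have h3 : ‖m y' z' - m ys z‖ ≤ r / s * ‖z' - z‖ + ‖m ys z' - m y' z'‖ := by
      have := norm_sub_le_norm_sub_add_norm_sub (m y' z') (m ys z') (m ys z)
      rw [norm_sub_rev (m y' z') (m ys z), norm_sub_rev (m y' z') (m ys z')] at this
      rw [norm_sub_rev (m y' z') (m ys z)]
      linarith
    have h4 := mul_le_mul_of_nonneg_left h3 (norm_nonneg (z' - z))
    linarith
  have i5 := mul_le_mul_of_nonneg_left i4 hr.le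
  linarith

end Abstract

section Frobenius

/-- The inner product space core given by the Frobenius inner product. -/
@[reducible] def frobCore (m n : ℕ) : InnerProductSpace.Core ℝ (Matrix (Fin m) (Fin n) ℝ) where
  inner := frobInner
  conj_inner_symm x y := by
    change frobInner y x = frobInner x y
    unfold frobInner
    rw [← Matrix.trace_transpose, Matrix.transpose_mul, Matrix.transpose_transpose]
  re_inner_nonneg x := by
    change 0 ≤ frobInner x x
    simp only [frobInner, Matrix.trace, Matrix.diag, Matrix.mul_apply, Matrix.transpose_apply]
    exact Finset.sum_nonneg fun _ _ => Finset.sum_nonneg fun _ _ => mul_self_nonneg _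
  add_left x y z := by simp [frobInner, Matrix.add_mul]
  smul_left x y r := by simp [frobInner]
  definite x hx := by
    change frobInner x x = 0 at hx
    simp only [frobInner, Matrix.trace, Matrix.diag, Matrix.mul_apply,
      Matrix.transpose_apply] at hx
    rw [Finset.sum_eq_zero_iff_of_nonneg
      fun _ _ => Finset.sum_nonneg fun _ _ => mul_self_nonneg _] at hx
    ext i j
    have h := hx j (Finset.mem_univ _)
    rw [Finset.sum_eq_zero_iff_of_nonneg fun _ _ => mul_self_nonneg _] at h
    exact mul_self_eq_zero.1 (h i (Finset.mem_univ _))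

/-- The Frobenius norm structure on matrices. -/
@[reducible] def frobNormedAddCommGroup (m n : ℕ) :
    NormedAddCommGroup (Matrix (Fin m) (Fin n) ℝ) :=
  (frobCore m n).toNormedAddCommGroup

attribute [local instance] frobNormedAddCommGroup

/-- The Frobenius inner product space structure on matrices. -/
@[reducible] def frobInnerProductSpace (m n : ℕ) :
    InnerProductSpace ℝ (Matrix (Fin m) (Fin n) ℝ) :=
  InnerProductSpace.ofCore (frobCore m n).toCore

attribute [local instance] frobInnerProductSpace

open scoped RealInnerProductSpace

variable {m n p : ℕ}

lemma frobNorm_eq_norm (A : Matrix (Fin m) (Fin n) ℝ) : frobNorm A = ‖A‖ := rfl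

lemma frobInner_eq_inner (A B : Matrix (Fin m) (Fin n) ℝ) : frobInner A B = ⟪A, B⟫ := rfl

lemma inner_mul_left_eq (A : Matrix (Fin m) (Fin n) ℝ) (B : Matrix (Fin n) (Fin p) ℝ)
    (C : Matrix (Fin m) (Fin p) ℝ) : ⟪A * B, C⟫ = ⟪B, Aᵀ * C⟫ := by
  simp only [← frobInner_eq_inner, frobInner, Matrix.transpose_mul, Matrix.mul_assoc]

lemma inner_transpose (A B : Matrix (Fin m) (Fin n) ℝ) : ⟪Aᵀ, Bᵀ⟫ = ⟪A, B⟫ := by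
  simp only [← frobInner_eq_inner, frobInner]
  rw [Matrix.trace_mul_comm, ← Matrix.trace_transpose]
  simp

lemma norm_transpose_eq (A : Matrix (Fin m) (Fin n) ℝ) : ‖Aᵀ‖ = ‖A‖ := by
  rw [norm_eq_sqrt_real_inner, norm_eq_sqrt_real_inner, inner_transpose]

lemma norm_sq_eq_sum_cols (A : Matrix (Fin m) (Fin n) ℝ) :
    ‖A‖ ^ 2 = ∑ j, ‖WithLp.toLp 2 (fun i => A i j)‖ ^ 2 := by
  rw [← real_inner_self_eq_norm_sq, ← frobInner_eq_inner]
  simp only [frobInner, Matrix.trace, Matrix.diag, Matrix.mul_apply, Matrix.transpose_apply,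
    EuclideanSpace.norm_sq_eq, Real.norm_eq_abs, sq_abs]
  simp only [sq]

lemma specNorm_nonneg (A : Matrix (Fin m) (Fin n) ℝ) : 0 ≤ specNorm A := norm_nonneg _

lemma norm_mul_le_specNorm_mul (A : Matrix (Fin m) (Fin n) ℝ) (B : Matrix (Fin n) (Fin p) ℝ) :
    ‖A * B‖ ≤ specNorm A * ‖B‖ := by
  refine abs_le_of_sq_le_sq' ?_ (mul_nonneg (specNorm_nonneg A) (norm_nonneg B)) |>.2
  rw [mul_pow, norm_sq_eq_sum_cols, norm_sq_eq_sum_cols, Finset.mul_sum]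
  refine Finset.sum_le_sum fun j _ => ?_
  rw [← mul_pow]
  gcongr
  exact (LinearMap.toContinuousLinearMap (Matrix.toEuclideanLin A)).le_opNorm
    (WithLp.toLp 2 (fun i => B i j))

lemma norm_transpose_mul_le_specNorm_mul (A : Matrix (Fin m) (Fin n) ℝ)
    (B : Matrix (Fin m) (Fin p) ℝ) : ‖Aᵀ * B‖ ≤ specNorm A * ‖B‖ := by
  have h1 : ‖Aᵀ * B‖ ^ 2 ≤ ‖Aᵀ * B‖ * (specNorm A * ‖B‖) := by
    rw [← real_inner_self_eq_norm_sq]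
    conv_lhs => rw [← inner_mul_left_eq]
    refine (real_inner_le_norm _ _).trans ?_
    have := mul_le_mul_of_nonneg_right (norm_mul_le_specNorm_mul A (Aᵀ * B)) (norm_nonneg B)
    linarith
  rcases (norm_nonneg (Aᵀ * B)).eq_or_lt with h0 | h0
  · rw [← h0]; exact mul_nonneg (specNorm_nonneg A) (norm_nonneg B)
  · exact le_of_mul_le_mul_left (by linarith) h0

lemma norm_mul_le_norm_mul_norm (A : Matrix (Fin m) (Fin n) ℝ) (B : Matrix (Fin n) (Fin p) ℝ) :
    ‖A * B‖ ≤ ‖A‖ * ‖B‖ := by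
  have key : ∀ {a b : ℕ} (M : Matrix (Fin a) (Fin b) ℝ),
      @Norm.norm _ Matrix.frobeniusNormedAddCommGroup.toNorm M = ‖M‖ := by
    intro a b M
    rw [Matrix.frobenius_norm_def, ← Real.sqrt_eq_rpow, ← frobNorm_eq_norm, frobNorm]
    congr 1
    simp only [frobInner, Matrix.trace, Matrix.diag, Matrix.mul_apply, Matrix.transpose_apply]
    rw [Finset.sum_comm]
    simp [sq]
  rw [← key, ← key, ← key]
  exact Matrix.frobenius_norm_mul A B

lemma Gm_add (A H : Matrix (Fin m) (Fin n) ℝ) :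
    Gm (A + H) = Gm A + (Aᵀ * H + Hᵀ * A) + Hᵀ * H := by
  simp only [Gm, Matrix.transpose_add, Matrix.add_mul, Matrix.mul_add]
  abel

lemma Gm_isSymm (A : Matrix (Fin m) (Fin n) ℝ) : (Gm A).IsSymm := by
  simp [Gm, Matrix.IsSymm]

lemma Gm_lipschitz {A B : Matrix (Fin m) (Fin n) ℝ} {R : ℝ} (hA : specNorm A ≤ R)
    (hB : specNorm B ≤ R) : ‖Gm A - Gm B‖ ≤ 2 * R * ‖A - B‖ := by
  have h : Gm A - Gm B = Aᵀ * (A - B) + (Bᵀ * (A - B))ᵀ := by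
    simp only [Gm, Matrix.mul_sub, Matrix.transpose_mul, Matrix.transpose_sub,
      Matrix.transpose_transpose]
    abel
  rw [h]
  refine (norm_add_le _ _).trans ?_
  rw [norm_transpose_eq]
  have h1 := (norm_transpose_mul_le_specNorm_mul A (A - B)).trans
    (mul_le_mul_of_nonneg_right hA (norm_nonneg _))
  have h2 := (norm_transpose_mul_le_specNorm_mul B (A - B)).trans
    (mul_le_mul_of_nonneg_right hB (norm_nonneg _))
  linarith

lemma inner_symm_mul_add {Y : Matrix (Fin n) (Fin n) ℝ} (hY : Y.IsSymm)
    (A H : Matrix (Fin m) (Fin n) ℝ) :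
    ⟪Y, Aᵀ * H + Hᵀ * A⟫ = ⟪(2 : ℝ) • (A * Y), H⟫ := by
  have h1 : ⟪Y, Hᵀ * A⟫ = ⟪Y, Aᵀ * H⟫ := by
    rw [← inner_transpose, hY.eq, Matrix.transpose_mul, Matrix.transpose_transpose]
  rw [inner_add_right, h1, ← inner_mul_left_eq, inner_smul_left]
  simp only [conj_trivial]
  ring

lemma abs_inner_gram_le (Y : Matrix (Fin n) (Fin n) ℝ) (H : Matrix (Fin m) (Fin n) ℝ) :
    |⟪Y, Hᵀ * H⟫| ≤ ‖Y‖ * ‖H‖ ^ 2 := by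
  rw [← inner_mul_left_eq]
  refine (abs_real_inner_le_norm _ _).trans ?_
  have := mul_le_mul_of_nonneg_right (norm_mul_le_norm_mul_norm H Y) (norm_nonneg H)
  linarith

lemma inner_Gm_gram (A H : Matrix (Fin m) (Fin n) ℝ) :
    ⟪Gm A, Hᵀ * H⟫ = ‖A * Hᵀ‖ ^ 2 - ‖H‖ ^ 2 := by
  have h1 : ⟪Aᵀ * A, Hᵀ * H⟫ = ‖A * Hᵀ‖ ^ 2 := by
    rw [← real_inner_self_eq_norm_sq, inner_mul_left_eq, real_inner_comm]
    simp only [← frobInner_eq_inner, frobInner, Matrix.transpose_mul, Matrix.transpose_transpose]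
    rw [Matrix.trace_mul_comm]
    simp only [Matrix.mul_assoc]
    rw [← Matrix.mul_assoc, Matrix.trace_mul_comm]
    simp only [Matrix.mul_assoc]
  have h2 : ⟪(1 : Matrix (Fin n) (Fin n) ℝ), Hᵀ * H⟫ = ‖H‖ ^ 2 := by
    rw [← inner_mul_left_eq, Matrix.mul_one, real_inner_self_eq_norm_sq]
  rw [Gm, inner_sub_left, h1, h2]

/-- Second-order expansion of the multiplier term. -/
lemma inner_Gm_expand {Y : Matrix (Fin n) (Fin n) ℝ} (hY : Y.IsSymm)
    (A B : Matrix (Fin m) (Fin n) ℝ) :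
    |⟪Y, Gm B⟫ - ⟪Y, Gm A⟫ - ⟪(2 : ℝ) • (A * Y), B - A⟫| ≤ ‖Y‖ * ‖B - A‖ ^ 2 := by
  have h : B = A + (B - A) := by abel
  have h1 : ⟪Y, Gm B⟫ - ⟪Y, Gm A⟫ - ⟪(2 : ℝ) • (A * Y), B - A⟫ = ⟪Y, (B - A)ᵀ * (B - A)⟫ := by
    conv_lhs => rw [h, Gm_add, inner_add_right, inner_add_right, inner_symm_mul_add hY]
    rw [← h]
    ring
  rw [h1]
  exact abs_inner_gram_le _ _

/-- Second-order expansion of the quadratic penalty. -/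
lemma norm_Gm_sq_expand (A B : Matrix (Fin m) (Fin n) ℝ) :
    ‖Gm B‖ ^ 2 = ‖Gm A‖ ^ 2 + 2 * ⟪(2 : ℝ) • (A * Gm A), B - A⟫
      + 2 * (‖A * (B - A)ᵀ‖ ^ 2 - ‖B - A‖ ^ 2) + ‖Gm B - Gm A‖ ^ 2 := by
  have h : B = A + (B - A) := by abel
  have h1 : ⟪Gm A, Gm B - Gm A⟫ = ⟪(2 : ℝ) • (A * Gm A), B - A⟫
      + (‖A * (B - A)ᵀ‖ ^ 2 - ‖B - A‖ ^ 2) := by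
    rw [← inner_Gm_gram, ← inner_symm_mul_add (Gm_isSymm A), ← inner_add_right]
    conv_lhs => rw [h, Gm_add]
    congr 1
    abel
  have h2 : Gm B = Gm A + (Gm B - Gm A) := by abel
  conv_lhs => rw [h2, norm_add_sq_real, h1]
  ring

lemma norm_Gm_sq_lower (A B : Matrix (Fin m) (Fin n) ℝ) :
    ‖Gm A‖ ^ 2 + 2 * ⟪(2 : ℝ) • (A * Gm A), B - A⟫ - 2 * ‖B - A‖ ^ 2 ≤ ‖Gm B‖ ^ 2 := by
  rw [norm_Gm_sq_expand A B]
  nlinarith [sq_nonneg ‖A * (B - A)ᵀ‖, sq_nonneg ‖Gm B - Gm A‖]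

lemma norm_Gm_sq_upper {A B : Matrix (Fin m) (Fin n) ℝ} {R : ℝ} (hA : specNorm A ≤ R)
    (hB : specNorm B ≤ R) :
    ‖Gm B‖ ^ 2 ≤ ‖Gm A‖ ^ 2 + 2 * ⟪(2 : ℝ) • (A * Gm A), B - A⟫
      + 6 * R ^ 2 * ‖B - A‖ ^ 2 := by
  have hR : 0 ≤ R := (specNorm_nonneg A).trans hA
  rw [norm_Gm_sq_expand A B]
  have h1 : ‖A * (B - A)ᵀ‖ ^ 2 ≤ (R * ‖B - A‖) ^ 2 := by
    gcongr
    refine (norm_mul_le_specNorm_mul _ _).trans ?_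
    rw [norm_transpose_eq]
    gcongr
  have h2 : ‖Gm B - Gm A‖ ^ 2 ≤ (2 * R * ‖B - A‖) ^ 2 := by
    gcongr
    exact Gm_lipschitz hB hA
  nlinarith [sq_nonneg ‖B - A‖]

lemma hasDerivAt_line {gradl : Matrix (Fin m) (Fin n) ℝ → Matrix (Fin m) (Fin n) ℝ}
    {ℓ : Matrix (Fin m) (Fin n) ℝ → ℝ} (hgrad : IsGradientOf gradl ℓ)
    (A H : Matrix (Fin m) (Fin n) ℝ) (t : ℝ) :
    HasDerivAt (fun t : ℝ => ℓ (A + t • H)) ⟪gradl (A + t • H), H⟫ t := by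
  rw [hasDerivAt_iff_isLittleO, Asymptotics.isLittleO_iff]
  intro c hc
  obtain ⟨δ, hδ, h⟩ := hgrad (A + t • H) (c / (‖H‖ + 1)) (by positivity)
  filter_upwards [Metric.ball_mem_nhds t (show 0 < δ / (‖H‖ + 1) by positivity)] with s hs
  rw [Metric.mem_ball, Real.dist_eq, lt_div_iff₀ (by positivity)] at hs
  have hn : ‖(s - t) • H‖ = |s - t| * ‖H‖ := by rw [norm_smul, Real.norm_eq_abs]
  have h1 := h ((s - t) • H) (by
    rw [frobNorm_eq_norm, hn]
    nlinarith [abs_nonneg (s - t)])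
  have h2 : A + t • H + (s - t) • H = A + s • H := by module
  rw [h2, frobInner_eq_inner, frobNorm_eq_norm, hn, inner_smul_right] at h1
  rw [Real.norm_eq_abs, Real.norm_eq_abs, smul_eq_mul]
  refine h1.trans ?_
  rw [div_mul_eq_mul_div, div_le_iff₀ (by positivity)]
  nlinarith [mul_nonneg hc.le (abs_nonneg (s - t))]

/-- Two-sided quadratic bound for a function with Lipschitz gradient on a convex set. -/
lemma quadratic_bound_of_lipschitz_gradient
    {gradl : Matrix (Fin m) (Fin n) ℝ → Matrix (Fin m) (Fin n) ℝ}
    {ℓ : Matrix (Fin m) (Fin n) ℝ → ℝ} (hgrad : IsGradientOf gradl ℓ)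
    {X : Set (Matrix (Fin m) (Fin n) ℝ)} (hX : Convex ℝ X) {L : ℝ}
    (hLip : ∀ A ∈ X, ∀ B ∈ X, ‖gradl A - gradl B‖ ≤ L * ‖A - B‖)
    {A B : Matrix (Fin m) (Fin n) ℝ} (hA : A ∈ X) (hB : B ∈ X) :
    |ℓ B - ℓ A - ⟪gradl A, B - A⟫| ≤ L / 2 * ‖B - A‖ ^ 2 := by
  have hline : ∀ t ∈ Set.Icc (0 : ℝ) 1, A + t • (B - A) ∈ X := fun t ht =>
    hX.add_smul_sub_mem hA hB ht
  have hder := fun t : ℝ => hasDerivAt_line hgrad A (B - A) t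
  have hslope : ∀ t ∈ Set.Icc (0 : ℝ) 1,
      |⟪gradl (A + t • (B - A)), B - A⟫ - ⟪gradl A, B - A⟫| ≤ L * t * ‖B - A‖ ^ 2 := by
    intro t ht
    rw [← inner_sub_left]
    refine (abs_real_inner_le_norm _ _).trans ?_
    have h1 := hLip _ (hline t ht) _ hA
    have h2 : A + t • (B - A) - A = t • (B - A) := by abel
    rw [h2, norm_smul, Real.norm_of_nonneg ht.1] at h1
    nlinarith [norm_nonneg (B - A)]
  have hquad : ∀ σ t : ℝ, HasDerivAt
      (fun t : ℝ => σ * (ℓ A + t * ⟪gradl A, B - A⟫) + L / 2 * t ^ 2 * ‖B - A‖ ^ 2)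
      (σ * ⟪gradl A, B - A⟫ + L * t * ‖B - A‖ ^ 2) t := by
    intro σ t
    have h1 := (((hasDerivAt_id t).mul_const ⟪gradl A, B - A⟫).const_add (ℓ A)).const_mul σ
    have h2 := (((hasDerivAt_id t).pow 2).const_mul (L / 2)).mul_const (‖B - A‖ ^ 2)
    convert! h1.add h2 using 1
    simp only [id]
    push_cast
    ring
  have main : ∀ σ : ℝ, |σ| = 1 → σ * ℓ B ≤ σ * (ℓ A + ⟪gradl A, B - A⟫)
      + L / 2 * ‖B - A‖ ^ 2 := by
    intro σ hσ
    have h := image_le_of_deriv_right_le_deriv_boundary (a := (0 : ℝ)) (b := 1)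
      (f := fun t => σ * ℓ (A + t • (B - A)))
      (f' := fun t => σ * ⟪gradl (A + t • (B - A)), B - A⟫)
      (fun t _ => ((hder t).const_mul σ).continuousAt.continuousWithinAt)
      (fun t _ => ((hder t).const_mul σ).hasDerivWithinAt)
      (B := fun t => σ * (ℓ A + t * ⟪gradl A, B - A⟫) + L / 2 * t ^ 2 * ‖B - A‖ ^ 2)
      (B' := fun t => σ * ⟪gradl A, B - A⟫ + L * t * ‖B - A‖ ^ 2)
      (by simp)
      (fun t _ => (hquad σ t).continuousAt.continuousWithinAt)
      (fun t _ => (hquad σ t).hasDerivWithinAt)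
      (fun t ht => by
        have h1 := hslope t ⟨ht.1, ht.2.le⟩
        have h2 := le_abs_self
          (σ * (⟪gradl (A + t • (B - A)), B - A⟫ - ⟪gradl A, B - A⟫))
        rw [abs_mul, hσ, one_mul] at h2
        linarith)
      (Set.right_mem_Icc.2 zero_le_one)
    simpa using h
  have hp := main 1 (by simp)
  have hn := main (-1) (by simp)
  rw [abs_le]
  constructor <;> linarith

/-- Variational inequality for the metric projection. -/
lemma proj_variational {K : Set (Matrix (Fin m) (Fin n) ℝ)} (hK : Convex ℝ K)
    {W P : Matrix (Fin m) (Fin n) ℝ} (hP : P ∈ K)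
    (hmin : ∀ Y ∈ K, frobNorm (W - P) ≤ frobNorm (W - Y)) :
    ∀ Y ∈ K, ⟪W - P, Y - P⟫ ≤ 0 := by
  refine (norm_eq_iInf_iff_real_inner_le_zero hK hP).1 (le_antisymm ?_ ?_)
  · have : Nonempty K := ⟨⟨P, hP⟩⟩
    exact le_ciInf fun w => hmin w w.2
  · exact ciInf_le (f := fun w : K => ‖W - w‖)
      ⟨0, by rintro _ ⟨w, rfl⟩; exact norm_nonneg _⟩ ⟨P, hP⟩

lemma Ffun_eq_saddleFun (ℓ g : Matrix (Fin m) (Fin n) ℝ → ℝ) (ρ r ε : ℝ)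
    (X : Matrix (Fin m) (Fin n) ℝ) (Y : Matrix (Fin n) (Fin n) ℝ)
    (Z : Matrix (Fin m) (Fin n) ℝ) :
    Ffun ℓ g ρ r ε X Y Z
      = saddleFun (fun X => ℓ X + g X + ρ / 2 * ‖Gm X‖ ^ 2) Gm ε r X Y Z := by
  simp only [Ffun, Lag, saddleFun, frobNorm_eq_norm, frobInner_eq_inner]
  ring

/-- Two-sided quadratic bound for the smooth part of the augmented Lagrangian. -/
lemma smooth_part_bound {gradl : Matrix (Fin m) (Fin n) ℝ → Matrix (Fin m) (Fin n) ℝ}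
    {ℓ : Matrix (Fin m) (Fin n) ℝ → ℝ} (hgrad : IsGradientOf gradl ℓ)
    {X : Set (Matrix (Fin m) (Fin n) ℝ)} (hX : Convex ℝ X) {Lℓ RX RY ρ : ℝ} (hρ : 0 < ρ)
    (hXR : ∀ A ∈ X, specNorm A ≤ RX)
    (hLip : ∀ A ∈ X, ∀ B ∈ X, frobNorm (gradl A - gradl B) ≤ Lℓ * frobNorm (A - B))
    {Y : Matrix (Fin n) (Fin n) ℝ} (hY : Y.IsSymm) (hYR : frobNorm Y ≤ RY)
    {A B : Matrix (Fin m) (Fin n) ℝ} (hA : A ∈ X) (hB : B ∈ X) :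
    ℓ A + ⟪Y, Gm A⟫ + ρ / 2 * ‖Gm A‖ ^ 2
        + ⟪gradl A + (2 : ℝ) • (A * (Y + ρ • Gm A)), B - A⟫
        - (Lℓ + 2 * RY + 2 * ρ) / 2 * ‖B - A‖ ^ 2
      ≤ ℓ B + ⟪Y, Gm B⟫ + ρ / 2 * ‖Gm B‖ ^ 2 ∧
    ℓ B + ⟪Y, Gm B⟫ + ρ / 2 * ‖Gm B‖ ^ 2
      ≤ ℓ A + ⟪Y, Gm A⟫ + ρ / 2 * ‖Gm A‖ ^ 2
        + ⟪gradl A + (2 : ℝ) • (A * (Y + ρ • Gm A)), B - A⟫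
        + (Lℓ + 2 * RY + 6 * ρ * RX ^ 2 + 2 * ρ) / 2 * ‖B - A‖ ^ 2 := by
  have h1 := abs_le.1 (quadratic_bound_of_lipschitz_gradient hgrad hX hLip hA hB)
  have h2 := abs_le.1 (inner_Gm_expand hY A B)
  have h3 := mul_le_mul_of_nonneg_left (norm_Gm_sq_lower A B) hρ.le
  have h4 := mul_le_mul_of_nonneg_left (norm_Gm_sq_upper (hXR A hA) (hXR B hB)) hρ.le
  have h5 : ‖Y‖ * ‖B - A‖ ^ 2 ≤ RY * ‖B - A‖ ^ 2 :=
    mul_le_mul_of_nonneg_right hYR (sq_nonneg _)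
  have h6 : 0 ≤ ρ * ‖B - A‖ ^ 2 := by positivity
  have h7 : ⟪gradl A + (2 : ℝ) • (A * (Y + ρ • Gm A)), B - A⟫
      = ⟪gradl A, B - A⟫ + ⟪(2 : ℝ) • (A * Y), B - A⟫
        + ρ * ⟪(2 : ℝ) • (A * Gm A), B - A⟫ := by
    rw [inner_add_left, Matrix.mul_add, Matrix.mul_smul, smul_add, inner_add_left, smul_comm,
      inner_smul_left _ _ ρ]
    simp only [conj_trivial]
    ring
  rw [h7]
  constructor <;> linarith

lemma error_constant_bound {a e s κ C : ℝ} (ha : 0 ≤ a) (hs : 0 < s) (hκ : 0 < κ)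
    (hC : 0 ≤ C) (h : s * e ^ 2 ≤ (κ + C) * e * a + C * a ^ 2) :
    e ≤ (2 * (κ + C) / s + 1) * (√(2 * C / (κ + C)) + 1) * a := by
  obtain ⟨q, hq⟩ : ∃ q, q = (κ + C) / s := ⟨_, rfl⟩
  obtain ⟨θ, hθ⟩ : ∃ θ, θ = √(2 * C / (κ + C)) := ⟨_, rfl⟩
  have hq0 : 0 < q := by rw [hq]; positivity
  have hθ0 : 0 ≤ θ := by rw [hθ]; positivity
  have hCs : C / s = q * θ ^ 2 / 2 := by
    rw [hθ, Real.sq_sqrt (by positivity), hq]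
    have : κ + C ≠ 0 := by positivity
    field_simp
  have h1 : e ^ 2 ≤ q * e * a + q * θ ^ 2 / 2 * a ^ 2 := by
    rw [← hCs, hq]
    have : (κ + C) / s * e * a + C / s * a ^ 2 = ((κ + C) * e * a + C * a ^ 2) / s := by
      field_simp
    rw [this, le_div_iff₀ hs]
    linarith
  have h2 : 2 * (κ + C) / s = 2 * q := by rw [hq]; ring
  rw [h2, ← hθ]
  by_contra! hlt
  have h3 : q * a ≤ e := by
    have : q * a ≤ (2 * q + 1) * (θ + 1) * a := by
      gcongr
      nlinarith
    linarith
  have h4 : (q + 1) * (θ + 1) * a ≤ e - q * a := by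
    have : 0 ≤ q * θ * a := by positivity
    nlinarith
  have h5 : q * θ ^ 2 / 2 * a ^ 2 ≤ ((2 * q + 1) * (θ + 1) * a) * ((q + 1) * (θ + 1) * a) := by
    have : ((2 * q + 1) * (θ + 1) * a) * ((q + 1) * (θ + 1) * a) - q * θ ^ 2 / 2 * a ^ 2
      = a ^ 2 * ((2 * q ^ 2 + 5 / 2 * q + 1) * θ ^ 2
        + (2 * q + 1) * (q + 1) * (2 * θ + 1)) := by ring
    have h6 : 0 ≤ a ^ 2 * ((2 * q ^ 2 + 5 / 2 * q + 1) * θ ^ 2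
        + (2 * q + 1) * (q + 1) * (2 * θ + 1)) := by positivity
    linarith
  have h6 : 0 ≤ (q + 1) * (θ + 1) * a := by positivity
  have h7 : 0 ≤ (2 * q + 1) * (θ + 1) * a := by positivity
  rcases ha.eq_or_lt with h0 | h0
  · rw [← h0] at h1 hlt
    nlinarith
  · have h8 : 0 < (q + 1) * (θ + 1) * a := by positivity
    have h9 : ((2 * q + 1) * (θ + 1) * a) * ((q + 1) * (θ + 1) * a) < e * (e - q * a) :=
      mul_lt_mul hlt h4 h8 (by linarith)
    nlinarith

end Frobenius

lemma dfun_eq_of_minimizer {m n : ℕ} {𝒳 : Set (Matrix (Fin m) (Fin n) ℝ)}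
    {ℓ g : Matrix (Fin m) (Fin n) ℝ → ℝ} {ρ r ε : ℝ} {Y : Matrix (Fin n) (Fin n) ℝ}
    {Z M : Matrix (Fin m) (Fin n) ℝ} (hM : M ∈ 𝒳)
    (hmin : ∀ X ∈ 𝒳, Ffun ℓ g ρ r ε M Y Z ≤ Ffun ℓ g ρ r ε X Y Z) :
    dfun 𝒳 ℓ g ρ r ε Y Z = Ffun ℓ g ρ r ε M Y Z :=
  IsLeast.csInf_eq ⟨⟨M, hM, rfl⟩, by rintro _ ⟨X, hX, rfl⟩; exact hmin X hX⟩

/-- The dual function attains its maximum over a compact multiplier set. -/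
lemma exists_dual_maximizer {m n : ℕ} {𝒳 : Set (Matrix (Fin m) (Fin n) ℝ)}
    {𝒴 : Set (Matrix (Fin n) (Fin n) ℝ)} {ℓ g : Matrix (Fin m) (Fin n) ℝ → ℝ} {ρ r ε : ℝ}
    (h𝒴 : IsCompact 𝒴) (hne : 𝒴.Nonempty)
    {Xm : Matrix (Fin n) (Fin n) ℝ → Matrix (Fin m) (Fin n) ℝ → Matrix (Fin m) (Fin n) ℝ}
    (hXm : ∀ Y Z, Xm Y Z ∈ 𝒳 ∧ ∀ X' ∈ 𝒳, Ffun ℓ g ρ r ε (Xm Y Z) Y Z ≤ Ffun ℓ g ρ r ε X' Y Z)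
    (Z : Matrix (Fin m) (Fin n) ℝ) :
    ∃ Ys ∈ 𝒴, ∀ Y ∈ 𝒴, dfun 𝒳 ℓ g ρ r ε Y Z ≤ dfun 𝒳 ℓ g ρ r ε Ys Z := by
  have husc : UpperSemicontinuousOn (fun Y => dfun 𝒳 ℓ g ρ r ε Y Z) 𝒴 := by
    have : (fun Y => dfun 𝒳 ℓ g ρ r ε Y Z)
        = fun Y => ⨅ X : 𝒳, Ffun ℓ g ρ r ε X Y Z := by
      ext Y
      rw [dfun, sInf_image']
    rw [this]
    refine upperSemicontinuousOn_ciInf (fun Y _ => ?_) fun X => ?_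
    · refine ⟨Ffun ℓ g ρ r ε (Xm Y Z) Y Z, ?_⟩
      rintro _ ⟨X, rfl⟩
      exact (hXm Y Z).2 X X.2
    · refine (Continuous.continuousOn ?_).upperSemicontinuousOn
      unfold Ffun Lag frobNorm frobInner
      fun_prop
  exact husc.exists_isMaxOn hne h𝒴

/-- Elementary consequences of the step-size conditions. -/
lemma step_size_bounds {Lℓ Lg ρ RX RY r ε lam α β μρ Lρ ζ σ₂ ω : ℝ}
    (hLℓ : 0 ≤ Lℓ) (hLg : 0 ≤ Lg) (hRY : 0 ≤ RY)
    (hρ : 0 < ρ) (hε : 0 < ε) (hlam : 0 < lam) (hα : 0 < α)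
    (hμρ : μρ = (Lℓ + Lg) + 2 * RY + 2 * ρ)
    (hLρ : Lρ = Lℓ + 2 * RY + 6 * ρ * RX ^ 2 + 2 * ρ)
    (hr : μρ < r) (hαε : α ≤ ε⁻¹)
    (hζ : ζ = (2 * (lam⁻¹ + Lρ) / (r - μρ) + 1) * (Real.sqrt (2 * Lρ / (lam⁻¹ + Lρ)) + 1))
    (hσ₂ : σ₂ = 2 * RX / (r - μρ))
    (hω : ω = (1 / Real.sqrt (r - μρ)) * ((1 + (2 * σ₂ * RX + ε) * α) / (Real.sqrt ε * α)))
    (hrge : max (Lρ + Lg + 4 * RX) (3 * (Lρ + Lg)) ≤ r)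
    (hlamle : lam ≤ 1 / (2 * RX))
    (hαle : α ≤ min (1 / (20 * RX)) (1 / (8 * RX * ζ ^ 2)))
    (hβle : β ≤ 1 / 28 * min (min 1 ((r - μρ) ^ 2 / (2 * α * r * RX ^ 2))) (1 / (16 * r * ω ^ 2 * α))) :
    0 < RX ∧ 4 * RX ≤ r ∧ r / (r - μρ) ≤ 3 / 2 ∧ 4 * RX ≤ r - μρ ∧ α * RX ≤ 1 / 20 ∧ 0 ≤ ζ ∧
      α * RX * ζ ^ 2 ≤ 1 / 8 ∧ β ≤ 1 / 28 ∧
      r * (1 / (√(r - μρ) * √ε) * (1 / α + 2 * (2 * RX / (r - μρ)) * RX + ε)) ^ 2 * α * β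
        ≤ 1 / 448 ∧ ε ≤ 1 / α ∧ 2 * RX ≤ lam⁻¹ := by
  obtain ⟨hα1, hα2⟩ := le_min_iff.1 hαle
  obtain ⟨hr1, hr2⟩ := max_le_iff.1 hrge
  have hRX : 0 < RX := by
    by_contra! h
    have : 1 / (20 * RX) ≤ 0 := one_div_nonpos.2 (by linarith)
    linarith
  have hs : 0 < r - μρ := by linarith
  have hρR : 0 ≤ 6 * ρ * RX ^ 2 := by positivity
  have hLρ0 : 0 ≤ Lρ := by rw [hLρ]; positivity
  have hζ0 : 1 ≤ ζ := by
    rw [hζ]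
    have h1 : 0 ≤ 2 * (lam⁻¹ + Lρ) / (r - μρ) := by positivity
    have h2 := Real.sqrt_nonneg (2 * Lρ / (lam⁻¹ + Lρ))
    nlinarith
  have hr0 : 0 < r := by linarith
  have hσ0 : 0 ≤ σ₂ := by rw [hσ₂]; positivity
  have hω0 : 0 < ω := by
    rw [hω]
    have := Real.sqrt_pos.2 hs
    have := Real.sqrt_pos.2 hε
    positivity
  have hω' : 1 / (√(r - μρ) * √ε) * (1 / α + 2 * (2 * RX / (r - μρ)) * RX + ε) = ω := by
    rw [hω, ← hσ₂]
    have := (Real.sqrt_pos.2 hs).ne'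
    have := (Real.sqrt_pos.2 hε).ne'
    field_simp
    ring
  refine ⟨hRX, by linarith, ?_, by linarith, ?_, by linarith, ?_, ?_, ?_, ?_, ?_⟩
  · rw [div_le_iff₀ hs]; linarith
  · rw [le_div_iff₀ (by positivity)] at hα1; linarith
  · rw [le_div_iff₀ (by positivity)] at hα2; linarith
  · have := (min_le_left (min 1 ((r - μρ) ^ 2 / (2 * α * r * RX ^ 2)))
      (1 / (16 * r * ω ^ 2 * α))).trans (min_le_left _ _)
    linarith
  · have h1 := min_le_right (min 1 ((r - μρ) ^ 2 / (2 * α * r * RX ^ 2)))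
      (1 / (16 * r * ω ^ 2 * α))
    have h2 : β ≤ 1 / 28 * (1 / (16 * r * ω ^ 2 * α)) := by linarith
    rw [hω']
    have h3 : r * ω ^ 2 * α * β ≤ r * ω ^ 2 * α * (1 / 28 * (1 / (16 * r * ω ^ 2 * α))) := by
      gcongr
    refine h3.trans (le_of_eq ?_)
    field_simp
    norm_num
  · rw [one_div]
    exact (le_inv_comm₀ hα hε).1 hαε
  · rw [le_inv_comm₀ (by positivity) hlam, ← one_div]
    exact hlamle

section Descent

attribute [local instance] frobNormedAddCommGroup frobInnerProductSpace

open scoped RealInnerProductSpace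

/-- The potential function does not increase along one step of the linearized smoothed
augmented Lagrangian method. -/
lemma Phi_step_le {m n : ℕ}
    {𝒳 : Set (Matrix (Fin m) (Fin n) ℝ)} {𝒴 : Set (Matrix (Fin n) (Fin n) ℝ)}
    {ℓ g : Matrix (Fin m) (Fin n) ℝ → ℝ}
    {gradl : Matrix (Fin m) (Fin n) ℝ → Matrix (Fin m) (Fin n) ℝ}
    {Lℓ Lg ρ RX RY r ε lam α β μρ Lρ ζ σ₂ ω : ℝ}
    (hLℓ : 0 ≤ Lℓ) (hLg : 0 ≤ Lg)
    (h𝒳conv : Convex ℝ 𝒳) (h𝒳R : ∀ X ∈ 𝒳, specNorm X ≤ RX)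
    (hgrad : IsGradientOf gradl ℓ)
    (hgradLip : ∀ X ∈ 𝒳, ∀ X' ∈ 𝒳, frobNorm (gradl X - gradl X') ≤ Lℓ * frobNorm (X - X'))
    (hgwc : ConvexOn ℝ 𝒳 (fun X => g X + Lg / 2 * frobNorm X ^ 2))
    (h𝒴symm : ∀ Y ∈ 𝒴, Y.IsSymm) (h𝒴conv : Convex ℝ 𝒴) (h𝒴cpt : IsCompact 𝒴)
    (h𝒴R : ∀ Y ∈ 𝒴, frobNorm Y ≤ RY)
    (hρ : 0 < ρ) (hε : 0 < ε) (hlam : 0 < lam) (hα : 0 < α) (hβ0 : 0 < β)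
    (hμρ : μρ = (Lℓ + Lg) + 2 * RY + 2 * ρ)
    (hLρ : Lρ = Lℓ + 2 * RY + 6 * ρ * RX ^ 2 + 2 * ρ)
    (hr : μρ < r) (hαε : α ≤ ε⁻¹)
    (hζ : ζ = (2 * (lam⁻¹ + Lρ) / (r - μρ) + 1) * (Real.sqrt (2 * Lρ / (lam⁻¹ + Lρ)) + 1))
    (hσ₂ : σ₂ = 2 * RX / (r - μρ))
    (hω : ω = (1 / Real.sqrt (r - μρ)) * ((1 + (2 * σ₂ * RX + ε) * α) / (Real.sqrt ε * α)))
    (hrge : max (Lρ + Lg + 4 * RX) (3 * (Lρ + Lg)) ≤ r)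
    (hlamle : lam ≤ 1 / (2 * RX))
    (hαle : α ≤ min (1 / (20 * RX)) (1 / (8 * RX * ζ ^ 2)))
    (hβle : β ≤ 1 / 28 * min (min 1 ((r - μρ) ^ 2 / (2 * α * r * RX ^ 2))) (1 / (16 * r * ω ^ 2 * α)))
    {Xm : Matrix (Fin n) (Fin n) ℝ → Matrix (Fin m) (Fin n) ℝ → Matrix (Fin m) (Fin n) ℝ}
    (hXm : ∀ Y Z, Xm Y Z ∈ 𝒳 ∧ ∀ X' ∈ 𝒳, Ffun ℓ g ρ r ε (Xm Y Z) Y Z ≤ Ffun ℓ g ρ r ε X' Y Z)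
    {X X' Z Z' : Matrix (Fin m) (Fin n) ℝ} {Y Y' : Matrix (Fin n) (Fin n) ℝ}
    (hX : X ∈ 𝒳) (hY : Y ∈ 𝒴) (hX' : X' ∈ 𝒳)
    (hXmin : ∀ U ∈ 𝒳, LinLag ℓ g gradl ρ lam X X' Y + r / 2 * frobNorm (X' - Z) ^ 2
        ≤ LinLag ℓ g gradl ρ lam X U Y + r / 2 * frobNorm (U - Z) ^ 2)
    (hZ' : Z' = Z + β • (X' - Z)) (hY' : Y' ∈ 𝒴)
    (hYmin : ∀ W ∈ 𝒴, frobNorm (Y + α • (Gm X' - ε • Y) - Y')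
      ≤ frobNorm (Y + α • (Gm X' - ε • Y) - W)) :
    Phi 𝒳 𝒴 ℓ g ρ r ε X' Y' Z' ≤ Phi 𝒳 𝒴 ℓ g ρ r ε X Y Z := by
  have hRY : 0 ≤ RY := (Real.sqrt_nonneg _).trans (h𝒴R Y hY)
  obtain ⟨hRX, hr4, hrs, hs4, hαR, hζ0, hαζ, hβ28, hωβ, hεα, hκ⟩ :=
    step_size_bounds hLℓ hLg hRY hρ hε hlam hα hμρ hLρ hr hαε hζ hσ₂ hω hrge hlamle hαle hβle
  have hs : 0 < r - μρ := by linarith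
  have hκ0 : 0 < lam⁻¹ := inv_pos.2 hlam
  have hLρ0 : 0 ≤ Lρ := by rw [hLρ]; positivity
  obtain ⟨w, hw⟩ : ∃ w, w = Lℓ + 2 * RY + 2 * ρ := ⟨_, rfl⟩
  have hw0 : 0 ≤ w := by rw [hw]; positivity
  have hwL : w ≤ Lρ := by
    have : 0 ≤ 6 * ρ * RX ^ 2 := by positivity
    linarith
  have hsw : r - μρ = r - Lg - w := by rw [hμρ, hw]; ring
  have hbound : ∀ V ∈ 𝒴, ∀ A ∈ 𝒳, ∀ B ∈ 𝒳, _ := fun V hV A hA B hB =>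
    smooth_part_bound hgrad h𝒳conv hρ h𝒳R hgradLip (h𝒴symm V hV) (h𝒴R V hV) hA hB
  rw [← hw, ← hLρ] at hbound
  obtain ⟨φ, hφ⟩ : ∃ φ : Matrix (Fin m) (Fin n) ℝ → ℝ,
    φ = fun X => ℓ X + g X + ρ / 2 * ‖Gm X‖ ^ 2 := ⟨_, rfl⟩
  have hF : ∀ A V B, Ffun ℓ g ρ r ε A V B = saddleFun φ Gm ε r A V B := by
    intro A V B; rw [hφ]; exact Ffun_eq_saddleFun ℓ g ρ r ε A V B
  have hgrow : ∀ V ∈ 𝒴, ∀ B, ∀ U ∈ 𝒳, saddleFun φ Gm ε r (Xm V B) V B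
      + (r - μρ) / 2 * ‖U - Xm V B‖ ^ 2 ≤ saddleFun φ Gm ε r U V B := by
    intro V hV B U hU
    have := prox_quadratic_growth h𝒳conv (S := fun A => ℓ A + ⟪V, Gm A⟫ + ρ / 2 * ‖Gm A‖ ^ 2)
      (z := B) (r := r) hgwc (hXm V B).1 (fun U hU => (hbound V hV _ (hXm V B).1 U hU).2)
      (fun U hU => (hbound V hV _ (hXm V B).1 U hU).1) (fun U hU => by
        have := (hXm V B).2 U hU
        simp only [hF, saddleFun, hφ] at this
        linarith) hU
    simp only [saddleFun, hφ, hsw]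
    linarith
  have hlin : ∀ U ∈ 𝒳, ⟪gradl X + (2 : ℝ) • (X * (Y + ρ • Gm X)), X' - X⟫ + g X'
      + lam⁻¹ / 2 * ‖X' - X‖ ^ 2 + r / 2 * ‖X' - Z‖ ^ 2
      ≤ ⟪gradl X + (2 : ℝ) • (X * (Y + ρ • Gm X)), U - X⟫ + g U
        + lam⁻¹ / 2 * ‖U - X‖ ^ 2 + r / 2 * ‖U - Z‖ ^ 2 := by
    intro U hU
    have h1 := hXmin U hU
    have h2 : 1 / (2 * lam) = lam⁻¹ / 2 := by field_simp
    simp only [LinLag, frobNorm_eq_norm, frobInner_eq_inner, h2] at h1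
    rw [inner_add_left, inner_add_left]
    linarith
  have hprimal : saddleFun φ Gm ε r X' Y Z + (lam⁻¹ + 2 * RX) * ‖X - X'‖ ^ 2
      ≤ saddleFun φ Gm ε r X Y Z := by
    have h1 := prox_linear_descent h𝒳conv
      (S := fun A => ℓ A + ⟪Y, Gm A⟫ + ρ / 2 * ‖Gm A‖ ^ 2) hgwc hX hX'
      (hbound Y hY X hX X' hX').2 hlin
    have h2 : (lam⁻¹ + 2 * RX) * ‖X - X'‖ ^ 2
        ≤ (lam⁻¹ + (r - Lg - Lρ) / 2) * ‖X - X'‖ ^ 2 := by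
      have := (max_le_iff.1 hrge).1
      gcongr
      linarith
    simp only [saddleFun, hφ]
    linarith
  have herr : ‖Xm Y Z - X'‖ ≤ ζ * ‖X - X'‖ := by
    have h1 := prox_linear_error h𝒳conv
      (S := fun A => ℓ A + ⟪Y, Gm A⟫ + ρ / 2 * ‖Gm A‖ ^ 2) hgwc hX' (hXm Y Z).1 hw0 hwL hκ0.le
      (hbound Y hY X hX X' hX').2 (hbound Y hY X hX _ (hXm Y Z).1).1 hlin (by
        have := hgrow Y hY Z X' hX'
        simp only [saddleFun, hφ, hsw] at this
        linarith)
    rw [← hsw] at h1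
    rw [hζ]
    exact error_constant_bound (norm_nonneg _) hs hκ0 hLρ0 h1
  obtain ⟨Ys, hYs, hYsmax⟩ := exists_dual_maximizer (ℓ := ℓ) (g := g) (ρ := ρ) (r := r) (ε := ε)
    h𝒴cpt ⟨Y, hY⟩ hXm Z'
  obtain ⟨Yp, hYp, hYpmax⟩ := exists_dual_maximizer (ℓ := ℓ) (g := g) (ρ := ρ) (r := r) (ε := ε)
    h𝒴cpt ⟨Y, hY⟩ hXm Z
  have hd : ∀ V B, dfun 𝒳 ℓ g ρ r ε V B = saddleFun φ Gm ε r (Xm V B) V B := fun V B =>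
    (dfun_eq_of_minimizer (hXm V B).1 (hXm V B).2).trans (hF _ _ _)
  have hp : ∀ B V, V ∈ 𝒴 → (∀ W ∈ 𝒴, dfun 𝒳 ℓ g ρ r ε W B ≤ dfun 𝒳 ℓ g ρ r ε V B) →
      pfun 𝒳 𝒴 ℓ g ρ r ε B = dfun 𝒳 ℓ g ρ r ε V B := fun B V hV h =>
    IsGreatest.csSup_eq ⟨⟨V, hV, rfl⟩, by rintro _ ⟨W, hW, rfl⟩; exact h W hW⟩
  have key := potential_descent (p := pfun 𝒳 𝒴 ℓ g ρ r ε Z) (fun V B => (hXm V B).1)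
    (fun U hU V hV => Gm_lipschitz (h𝒳R U hU) (h𝒳R V hV)) hgrow hRX hs hr4 hrs hs4 hα hαR hζ0 hαζ
    hε hβ0 hβ28 hωβ hεα hκ hX' hY hY' hYs hprimal herr hZ' (proj_variational h𝒴conv hY' hYmin)
    (by rw [← hd, ← hd]; exact hYsmax _ hY')
    (by rw [hp Z Yp hYp hYpmax, ← hd]; exact hYpmax _ hYs)
  rw [Phi, Phi, hp Z' Ys hYs hYsmax, hF, hF, hd, hd, hd]
  exact key

end Descent

/-- Markov-type counting bound for a sequence with bounded partial sums of squares. -/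
lemma ncard_gt_mul_sq_le {u : ℕ → ℝ} (h0 : u 0 = 0) {K : ℕ} {δ B : ℝ}
    (hδ : 0 < δ) (hB : ∑ k ∈ Finset.range K, u (k + 1) ^ 2 ≤ B) :
    ({k : ℕ | k ≤ K ∧ δ < u k}.ncard : ℝ) * δ ^ 2 ≤ B := by
  classical
  have hset : {k : ℕ | k ≤ K ∧ δ < u k}
      = ((Finset.range (K + 1)).filter fun k => δ < u k : Finset ℕ) := by
    ext k
    simp
  rw [hset, Set.ncard_coe_finset, ← nsmul_eq_mul]
  calc _ ≤ ∑ k ∈ (Finset.range (K + 1)).filter (fun k => δ < u k), u k ^ 2 := by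
        refine Finset.card_nsmul_le_sum _ _ _ fun k hk => ?_
        have := (Finset.mem_filter.1 hk).2
        gcongr
    _ ≤ ∑ k ∈ Finset.range (K + 1), u k ^ 2 :=
        Finset.sum_le_sum_of_subset_of_nonneg (Finset.filter_subset _ _) fun _ _ _ => sq_nonneg _
    _ = ∑ k ∈ Finset.range K, u (k + 1) ^ 2 := by
        rw [Finset.sum_range_succ', h0]; simp
    _ ≤ B := hB

/-- The potential function dominates the regularized Lagrangian. -/
lemma Ffun_le_Phi {m n : ℕ} {𝒳 : Set (Matrix (Fin m) (Fin n) ℝ)}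
    {𝒴 : Set (Matrix (Fin n) (Fin n) ℝ)} {ℓ g : Matrix (Fin m) (Fin n) ℝ → ℝ} {ρ r ε : ℝ}
    (h𝒴 : IsCompact 𝒴)
    {Xm : Matrix (Fin n) (Fin n) ℝ → Matrix (Fin m) (Fin n) ℝ → Matrix (Fin m) (Fin n) ℝ}
    (hXm : ∀ Y Z, Xm Y Z ∈ 𝒳 ∧ ∀ X' ∈ 𝒳, Ffun ℓ g ρ r ε (Xm Y Z) Y Z ≤ Ffun ℓ g ρ r ε X' Y Z)
    (X Z : Matrix (Fin m) (Fin n) ℝ) {Y : Matrix (Fin n) (Fin n) ℝ} (hY : Y ∈ 𝒴) :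
    Ffun ℓ g ρ r ε X Y Z ≤ Phi 𝒳 𝒴 ℓ g ρ r ε X Y Z := by
  obtain ⟨Ys, -, hmax⟩ := exists_dual_maximizer h𝒴 ⟨Y, hY⟩ hXm Z
  have h : dfun 𝒳 ℓ g ρ r ε Y Z ≤ pfun 𝒳 𝒴 ℓ g ρ r ε Z :=
    le_csSup ⟨dfun 𝒳 ℓ g ρ r ε Ys Z, by rintro _ ⟨W, hW, rfl⟩; exact hmax W hW⟩ ⟨Y, hY, rfl⟩
  rw [Phi]
  linarith

section Feasibility

attribute [local instance] frobNormedAddCommGroup frobInnerProductSpace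

open scoped RealInnerProductSpace

/-- Lower bound for the regularized dual term after a projected ascent step. -/
lemma projected_ascent_lower {n : ℕ} {K : Set (Matrix (Fin n) (Fin n) ℝ)} (hK : Convex ℝ K)
    (h0 : (0 : Matrix (Fin n) (Fin n) ℝ) ∈ K) {α ε : ℝ} (hα : 0 < α) (hε : 0 < ε)
    (hαε : α ≤ ε⁻¹) {Y Y' D : Matrix (Fin n) (Fin n) ℝ} (hY' : Y' ∈ K)
    (hmin : ∀ W ∈ K, frobNorm (Y + α • (D - ε • Y) - Y') ≤ frobNorm (Y + α • (D - ε • Y) - W)) :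
    (frobNorm Y' ^ 2 - frobNorm Y ^ 2) / (2 * α) ≤ frobInner Y' D - ε / 2 * frobNorm Y' ^ 2 := by
  have h1 := proj_variational hK hY' hmin 0 h0
  have hαε' : α * ε ≤ 1 := by
    have := mul_le_mul_of_nonneg_right hαε hε.le
    rwa [inv_mul_cancel₀ hε.ne'] at this
  have h2 : ‖Y'‖ ^ 2 ≤ (1 - α * ε) * ⟪Y, Y'⟫ + α * ⟪D, Y'⟫ := by
    rw [zero_sub, inner_neg_right, inner_sub_left, inner_add_left, inner_smul_left,
      inner_sub_left, inner_smul_left, real_inner_self_eq_norm_sq] at h1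
    simp only [conj_trivial] at h1
    linarith
  have h3 : ⟪Y, Y'⟫ ≤ (‖Y‖ ^ 2 + ‖Y'‖ ^ 2) / 2 := by
    have := real_inner_le_norm Y Y'
    nlinarith [sq_nonneg (‖Y‖ - ‖Y'‖)]
  have h4 := mul_le_mul_of_nonneg_left h3 (sub_nonneg.2 hαε')
  have h5 : 0 ≤ α * ε * ‖Y‖ ^ 2 := by positivity
  rw [div_le_iff₀ (by positivity), frobNorm_eq_norm, frobNorm_eq_norm, frobInner_eq_inner,
    real_inner_comm D Y']
  linarith

/-- A Lipschitz bound on a set of bounded spectral norm gives a lower bound there. -/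
lemma exists_lower_bound {m n : ℕ} {𝒳 : Set (Matrix (Fin m) (Fin n) ℝ)}
    {h : Matrix (Fin m) (Fin n) ℝ → ℝ} {L R : ℝ} (hR : ∀ X ∈ 𝒳, specNorm X ≤ R)
    (hLip : ∀ X ∈ 𝒳, ∀ X' ∈ 𝒳, |h X - h X'| ≤ L * frobNorm (X - X')) :
    ∃ b, ∀ X ∈ 𝒳, b ≤ h X := by
  rcases 𝒳.eq_empty_or_nonempty with rfl | ⟨X₀, hX₀⟩
  · exact ⟨0, by simp⟩
  obtain ⟨D, hD⟩ : ∃ D, D = R * ‖(1 : Matrix (Fin n) (Fin n) ℝ)‖ := ⟨_, rfl⟩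
  have hb : ∀ X ∈ 𝒳, ‖X‖ ≤ D := by
    intro X hX
    have h1 := norm_mul_le_specNorm_mul X (1 : Matrix (Fin n) (Fin n) ℝ)
    rw [Matrix.mul_one] at h1
    rw [hD]
    exact h1.trans (mul_le_mul_of_nonneg_right (hR X hX) (norm_nonneg _))
  refine ⟨h X₀ - |L| * (D + D), fun X hX => ?_⟩
  have h1 := (abs_le.1 (hLip X hX X₀ hX₀)).1
  have h2 : L * frobNorm (X - X₀) ≤ |L| * (D + D) := by
    rw [frobNorm_eq_norm]
    refine mul_le_mul (le_abs_self L) ?_ (norm_nonneg _) (abs_nonneg L)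
    exact (norm_sub_le _ _).trans (add_le_add (hb X hX) (hb X₀ hX₀))
  linarith

lemma frobNorm_Gm_eq_zero {m n : ℕ} {X : Matrix (Fin m) (Fin n) ℝ} (h : Xᵀ * X = 1) :
    frobNorm (Gm X) = 0 := by
  rw [frobNorm_eq_norm, Gm, h, sub_self, norm_zero]

lemma frobNorm_sub_neg_pos {m n : ℕ} [NeZero n] {X : Matrix (Fin m) (Fin n) ℝ} (h : Xᵀ * X = 1) :
    0 < frobNorm (X - -X) := by
  rw [frobNorm_eq_norm, norm_pos_iff, sub_neg_eq_add, ← two_smul ℝ X]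
  refine smul_ne_zero two_ne_zero ?_
  rintro rfl
  simp at h

end Feasibility

/-- Primal boundedness / approximate feasibility: at most `2K(Φ⁰ − f_min)/(ρδ²)` of the
iterates `X⁰, …, X^K` violate `‖G(X^k)‖_F ≤ δ`. -/
theorem primal_feasibility_count {m n : ℕ} (hmn : n ≤ m)
    (𝒳 : Set (Matrix (Fin m) (Fin n) ℝ)) (𝒴 : Set (Matrix (Fin n) (Fin n) ℝ))
    (ℓ g : Matrix (Fin m) (Fin n) ℝ → ℝ)
    (gradl : Matrix (Fin m) (Fin n) ℝ → Matrix (Fin m) (Fin n) ℝ)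
    (Lℓ Lg ρ RX RY r ε lam α β μρ Lρ ζ σ₂ ω fmin Φ0 : ℝ)
    (h𝒳conv : Convex ℝ 𝒳) (h𝒳cpt : IsCompact 𝒳)
    (h𝒳R : ∀ X ∈ 𝒳, specNorm X ≤ RX)
    (h𝒳big : {X : Matrix (Fin m) (Fin n) ℝ | frobNorm (Gm X) ≤ 1} ⊆ 𝒳)
    (hgrad : IsGradientOf gradl ℓ) (hgradcont : Continuous gradl)
    (hgradLip : ∀ X ∈ 𝒳, ∀ X' ∈ 𝒳, frobNorm (gradl X - gradl X') ≤ Lℓ * frobNorm (X - X'))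
    (hgwc : ConvexOn ℝ 𝒳 (fun X => g X + Lg / 2 * frobNorm X ^ 2))
    (hℓLip : ∀ X ∈ 𝒳, ∀ X' ∈ 𝒳, |ℓ X - ℓ X'| ≤ Lℓ * frobNorm (X - X'))
    (hgLip : ∀ X ∈ 𝒳, ∀ X' ∈ 𝒳, |g X - g X'| ≤ Lg * frobNorm (X - X'))
    (h𝒴symm : ∀ Y ∈ 𝒴, Y.IsSymm) (h𝒴conv : Convex ℝ 𝒴) (h𝒴cpt : IsCompact 𝒴)
    (h𝒴zero : (0 : Matrix (Fin n) (Fin n) ℝ) ∈ 𝒴)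
    (h𝒴R : ∀ Y ∈ 𝒴, frobNorm Y ≤ RY)
    (hρ : 0 < ρ) (hε : 0 < ε) (hlam : 0 < lam) (hα : 0 < α) (hβ0 : 0 < β) (hβ1 : β < 1)
    (hμρ : μρ = (Lℓ + Lg) + 2 * RY + 2 * ρ)
    (hLρ : Lρ = Lℓ + 2 * RY + 6 * ρ * RX ^ 2 + 2 * ρ)
    (hr : μρ < r) (hlamg : Lg < lam⁻¹) (hαε : α ≤ ε⁻¹)
    (hζ : ζ = (2 * (lam⁻¹ + Lρ) / (r - μρ) + 1) * (Real.sqrt (2 * Lρ / (lam⁻¹ + Lρ)) + 1))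
    (hσ₂ : σ₂ = 2 * RX / (r - μρ))
    (hω : ω = (1 / Real.sqrt (r - μρ)) * ((1 + (2 * σ₂ * RX + ε) * α) / (Real.sqrt ε * α)))
    (hrge : max (Lρ + Lg + 4 * RX) (3 * (Lρ + Lg)) ≤ r)
    (hlamle : lam ≤ 1 / (2 * RX))
    (hαle : α ≤ min (1 / (20 * RX)) (1 / (8 * RX * ζ ^ 2)))
    (hβle : β ≤ 1 / 28 * min (min 1 ((r - μρ) ^ 2 / (2 * α * r * RX ^ 2))) (1 / (16 * r * ω ^ 2 * α)))
    (Xm : Matrix (Fin n) (Fin n) ℝ → Matrix (Fin m) (Fin n) ℝ → Matrix (Fin m) (Fin n) ℝ)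
    (hXm : ∀ Y Z, Xm Y Z ∈ 𝒳 ∧ ∀ X' ∈ 𝒳, Ffun ℓ g ρ r ε (Xm Y Z) Y Z ≤ Ffun ℓ g ρ r ε X' Y Z)
    (proj : Matrix (Fin n) (Fin n) ℝ → Matrix (Fin n) (Fin n) ℝ)
    (hproj : ∀ W, proj W ∈ 𝒴 ∧ ∀ Y' ∈ 𝒴, frobNorm (W - proj W) ≤ frobNorm (W - Y'))
    (XS ZS : ℕ → Matrix (Fin m) (Fin n) ℝ) (YS : ℕ → Matrix (Fin n) (Fin n) ℝ)
    (hX0 : XS 0 ∈ 𝒳) (hX0feas : (XS 0)ᵀ * XS 0 = 1) (hY0 : YS 0 = 0) (hZ0 : ZS 0 = XS 0)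
    (hXit : ∀ k : ℕ, XS (k + 1) ∈ 𝒳 ∧ ∀ X' ∈ 𝒳,
      LinLag ℓ g gradl ρ lam (XS k) (XS (k + 1)) (YS k)
          + r / 2 * frobNorm (XS (k + 1) - ZS k) ^ 2
        ≤ LinLag ℓ g gradl ρ lam (XS k) X' (YS k) + r / 2 * frobNorm (X' - ZS k) ^ 2)
    (hZit : ∀ k : ℕ, ZS (k + 1) = ZS k + β • (XS (k + 1) - ZS k))
    (hYit : ∀ k : ℕ, YS (k + 1) = proj (YS k + α • (Gm (XS (k + 1)) - ε • YS k)))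
    (hfmin : fmin = sInf ((fun X => ℓ X + g X) '' 𝒳))
    (hΦ0 : Φ0 = Phi 𝒳 𝒴 ℓ g ρ r ε (XS 0) (YS 0) (ZS 0)) :
    ∀ K : ℕ, 1 ≤ K → ∀ δ : ℝ, 0 < δ →
      (({k : ℕ | k ≤ K ∧ δ < frobNorm (Gm (XS k))}.ncard : ℝ))
        ≤ 2 * K * (Φ0 - fmin) / (ρ * δ ^ 2) := by
  have hXmem : ∀ k, XS k ∈ 𝒳 := fun k => by
    cases k with
    | zero => exact hX0
    | succ k => exact (hXit k).1
  have hYmem : ∀ k, YS k ∈ 𝒴 := fun k => by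
    cases k with
    | zero => rw [hY0]; exact h𝒴zero
    | succ k => rw [hYit]; exact (hproj _).1
  have hYmin : ∀ k, ∀ W ∈ 𝒴,
      frobNorm (YS k + α • (Gm (XS (k + 1)) - ε • YS k) - YS (k + 1))
        ≤ frobNorm (YS k + α • (Gm (XS (k + 1)) - ε • YS k) - W) := fun k W hW => by
    rw [hYit]; exact (hproj _).2 W hW
  have hsign : n = 0 ∨ 0 ≤ Lℓ ∧ 0 ≤ Lg := by
    rcases Nat.eq_zero_or_pos n with hn | hn
    · exact Or.inl hn
    · have : NeZero n := ⟨hn.ne'⟩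
      have hneg : -XS 0 ∈ 𝒳 := h𝒳big (by
        have h : (-XS 0)ᵀ * -XS 0 = 1 := by
          rw [Matrix.transpose_neg, Matrix.neg_mul, Matrix.mul_neg, neg_neg, hX0feas]
        rw [Set.mem_ofPred_eq, frobNorm_Gm_eq_zero h]
        exact zero_le_one)
      have hpos := frobNorm_sub_neg_pos hX0feas
      exact Or.inr
        ⟨nonneg_of_mul_nonneg_left ((abs_nonneg _).trans (hℓLip _ hX0 _ hneg)) hpos,
          nonneg_of_mul_nonneg_left ((abs_nonneg _).trans (hgLip _ hX0 _ hneg)) hpos⟩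
  have hstep : ∀ k, Phi 𝒳 𝒴 ℓ g ρ r ε (XS (k + 1)) (YS (k + 1)) (ZS (k + 1))
      ≤ Phi 𝒳 𝒴 ℓ g ρ r ε (XS k) (YS k) (ZS k) := by
    intro k
    rcases hsign with rfl | ⟨hLℓ, hLg⟩
    · rw [Subsingleton.elim (XS (k + 1)) (XS k), Subsingleton.elim (YS (k + 1)) (YS k),
        Subsingleton.elim (ZS (k + 1)) (ZS k)]
    · exact Phi_step_le hLℓ hLg h𝒳conv h𝒳R hgrad hgradLip hgwc h𝒴symm h𝒴conv h𝒴cpt h𝒴R hρ hε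
        hlam hα hβ0 hμρ hLρ hr hαε hζ hσ₂ hω hrge hlamle hαle hβle hXm (hXmem k) (hYmem k)
        (hXit k).1 (hXit k).2 (hZit k) (hYmem (k + 1)) (hYmin k)
  have hΦ : ∀ k, Phi 𝒳 𝒴 ℓ g ρ r ε (XS k) (YS k) (ZS k) ≤ Φ0 := fun k => by
    induction k with
    | zero => exact hΦ0.ge
    | succ k ih => exact (hstep k).trans ih
  have hfle : ∀ X ∈ 𝒳, fmin ≤ ℓ X + g X := by
    intro X hX
    obtain ⟨b, hb⟩ := exists_lower_bound h𝒳R hℓLip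
    obtain ⟨c, hc⟩ := exists_lower_bound h𝒳R hgLip
    rw [hfmin]
    exact csInf_le ⟨b + c, by rintro _ ⟨A, hA, rfl⟩; exact add_le_add (hb A hA) (hc A hA)⟩
      ⟨X, hX, rfl⟩
  have hiter : ∀ k, ρ / 2 * frobNorm (Gm (XS (k + 1))) ^ 2
      + (frobNorm (YS (k + 1)) ^ 2 - frobNorm (YS k) ^ 2) / (2 * α) ≤ Φ0 - fmin := by
    intro k
    have h1 := (Ffun_le_Phi h𝒴cpt hXm (XS (k + 1)) (ZS (k + 1)) (hYmem (k + 1))).trans (hΦ (k + 1))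
    have h2 := hfle _ (hXmem (k + 1))
    have h3 := projected_ascent_lower h𝒴conv h𝒴zero hα hε hαε (hYmem (k + 1)) (hYmin k)
    have h4 : 0 ≤ r / 2 * frobNorm (XS (k + 1) - ZS (k + 1)) ^ 2 := by
      rcases hsign with rfl | ⟨hLℓ, hLg⟩
      · simp [frobNorm, frobInner, Matrix.trace]
      · have hRY : 0 ≤ RY := (Real.sqrt_nonneg _).trans (h𝒴R _ h𝒴zero)
        have : 0 ≤ r := by linarith
        positivity
    rw [Ffun, Lag] at h1
    linarith
  intro K _ δ hδ
  have hsum : ∑ k ∈ Finset.range K, frobNorm (Gm (XS (k + 1))) ^ 2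
      ≤ 2 * K * (Φ0 - fmin) / ρ := by
    have h1 := Finset.sum_le_sum fun k (_ : k ∈ Finset.range K) => hiter k
    rw [Finset.sum_add_distrib, ← Finset.mul_sum, ← Finset.sum_div,
      Finset.sum_range_sub (fun k => frobNorm (YS k) ^ 2), Finset.sum_const, Finset.card_range,
      nsmul_eq_mul] at h1
    have h2 : frobNorm (YS 0) = 0 := by simp [hY0, frobNorm, frobInner]
    have h3 : 0 ≤ (frobNorm (YS K) ^ 2 - frobNorm (YS 0) ^ 2) / (2 * α) := by
      rw [h2]
      have : (0 : ℝ) ^ 2 = 0 := by norm_num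
      rw [this, sub_zero]
      positivity
    rw [le_div_iff₀ hρ]
    linarith
  have hcount := ncard_gt_mul_sq_le (u := fun k => frobNorm (Gm (XS k)))
    (frobNorm_Gm_eq_zero hX0feas) hδ hsum
  rw [← div_div, le_div_iff₀ (by positivity)]
  exact hcount

end
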